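/- Let Γ=(V,E) be an infinite, locally finite tree rooted at 0 satisfying log br(Γ) = h(Γ), and let X_0 be a random 3-coloring of V drawn from the product measure with marginals P(X_0(σ)=i)=p_i for i ∈ ℤ/3ℤ (p_0,p_1,p_2 > 0, p_0+p_1+p_2=1). Let v_c be the cloud speed of the Γ-indexed walk S_σ = ∫_{P_σ} dX_0 associated to the 3-color CCA. Then, almost surely: if br(Γ) ≥ (p_0 p_1 p_2)^{−1/3}, then v_c = 1; otherwise v_c < 1 and Λ*_CCA(v_c) = h̄(Γ). -/

import Mathlib

noncomputable section
attribute [local instance] Classical.propDecidable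

open Filter MeasureTheory

variable {V : Type*}

/-- Unique representative in `{-1,0,1}` of an element of `ℤ/3ℤ`. -/
def ZMod.repInt (a : ZMod 3) : ℤ := if a = 0 then 0 else if a = 1 then 1 else -1

/-- The CCA 1-form `dX` on ordered pairs of vertices. -/
def dXcca (X : V → ZMod 3) (u v : V) : ℤ := (X v - X u).repInt

/-- Path integral of the CCA 1-form along a walk. -/
def walkIntCCA {G : SimpleGraph V} (X : V → ZMod 3) {x y : V} (w : G.Walk x y) : ℤ :=
  (w.darts.map fun d => dXcca X d.toProd.1 d.toProd.2).sum

/-- The largest positive root `x(t)` of `x³ − x² = q(e^{3t} + e^{−3t} − 2)`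
(here `q = p₀p₁p₂`). -/
def cubicRoot (q t : ℝ) : ℝ :=
  sSup {x : ℝ | 0 < x ∧ x ^ 3 - x ^ 2 = q * (Real.exp (3 * t) + Real.exp (-(3 * t)) - 2)}

/-- `Λ_CCA(t) = log x(t)`. -/
def LambdaCCA (q t : ℝ) : ℝ := Real.log (cubicRoot q t)

/-- The Legendre transform `Λ*_CCA(u) = sup_{t ≥ 0} (ut − Λ_CCA(t))`, valued in `EReal`. -/
def LstarCCA (q u : ℝ) : EReal :=
  ⨆ t : Set.Ici (0 : ℝ), ((u * t.1 - LambdaCCA q t.1 : ℝ) : EReal)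

/-- `τ` is a descendant of `σ` in the tree `G` rooted at `r`. -/
def IsDesc (G : SimpleGraph V) (r σ τ : V) : Prop :=
  G.dist r τ = G.dist r σ + G.dist σ τ

/-- `A_{n,m}`: the number of vertices at level `n` having a descendant at level `m`. -/
def levelSurvivorCount (G : SimpleGraph V) (r : V) (n m : ℕ) : ℕ :=
  Set.ncard {σ : V | G.dist r σ = n ∧ ∃ τ : V, IsDesc G r σ τ ∧ G.dist r τ = m}

/-- The `ρ`-volume entropy `h_ρ(Γ) = limsup_n (1/n) log A_{n,⌊ρn⌋}`, valued in `EReal`. -/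
def rVolumeEntropy (G : SimpleGraph V) (r : V) (ρ : ℝ) : EReal :=
  limsup (fun n : ℕ =>
    ((Real.log (levelSurvivorCount G r n ⌊ρ * n⌋₊) / n : ℝ) : EReal)) atTop

/-- The reduced volume entropy `h̄(Γ) = limsup_{ρ ↘ 1} h_ρ(Γ)`. -/
def reducedVolumeEntropy (G : SimpleGraph V) (r : V) : EReal :=
  limsup (fun ρ : ℝ => rVolumeEntropy G r ρ) (nhdsWithin 1 (Set.Ioi (1 : ℝ)))

/-- The volume entropy `h(Γ) = limsup_n (1/n) log A_n`, where `A_n` is the number of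
vertices at level `n`, valued in `EReal`. -/
def volumeEntropy (G : SimpleGraph V) (r : V) : EReal :=
  limsup (fun n : ℕ =>
    ((Real.log (Set.ncard {σ : V | G.dist r σ = n}) / n : ℝ) : EReal)) atTop

/-- A cutset: a finite set of vertices not containing the root `r`, meeting every
infinite injective path from `r`, and containing no ancestor-descendant pair. -/
def IsCutset (G : SimpleGraph V) (r : V) (C : Finset V) : Prop :=
  r ∉ C ∧
  (∀ γ : ℕ → V, γ 0 = r → (∀ n, G.Adj (γ n) (γ (n + 1))) → Function.Injective γ →
    ∃ n, γ n ∈ C) ∧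
  (∀ σ ∈ C, ∀ τ ∈ C, σ ≠ τ → ¬ IsDesc G r σ τ)

/-- The branching number `br(Γ) = inf { λ > 0 : inf_Π Σ_{σ∈Π} λ^{−|σ|} = 0 }`. -/
def branchingNumber (G : SimpleGraph V) (r : V) : ℝ :=
  sInf {l : ℝ | 0 < l ∧ ∀ ε > (0 : ℝ), ∃ C : Finset V, IsCutset G r C ∧
    ∑ σ ∈ C, l ^ (-(G.dist r σ : ℤ)) < ε}

/-- The cloud speed of the tree-indexed walk `S` on the tree `G` rooted at `r`. -/
def cloudSpeed (G : SimpleGraph V) (r : V) (S : V → ℤ) : ℝ :=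
  limsup (fun n : ℕ =>
    sSup {x : ℝ | ∃ σ : V, G.dist r σ = n ∧ (S σ : ℝ) = x} / n) atTop

/-! ### Part A: the cubic root -/

/-- right-hand side of the cubic equation -/
def cubF (q t : ℝ) : ℝ := q * (Real.exp (3 * t) + Real.exp (-(3 * t)) - 2)

/-- derivative of the right-hand side -/
def cubF' (q t : ℝ) : ℝ := 3 * q * (Real.exp (3 * t) - Real.exp (-(3 * t)))

lemma exp_mul_neg3 (t : ℝ) : Real.exp (3 * t) * Real.exp (-(3 * t)) = 1 := by
  rw [← Real.exp_add]; simp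

lemma cubF_nonneg {q : ℝ} (hq : 0 < q) (t : ℝ) : 0 ≤ cubF q t := by
  have h := exp_mul_neg3 t
  have h1 := Real.exp_pos (3 * t)
  have h2 := Real.exp_pos (-(3 * t))
  unfold cubF
  apply mul_nonneg hq.le
  nlinarith [sq_nonneg (Real.exp (3 * t) - Real.exp (-(3 * t)))]

lemma cubF_pos {q : ℝ} (hq : 0 < q) {t : ℝ} (ht : 0 < t) : 0 < cubF q t := by
  have h := exp_mul_neg3 t
  have h1 : 1 < Real.exp (3 * t) := Real.one_lt_exp_iff.2 (by linarith)
  have h2 := Real.exp_pos (-(3 * t))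
  have h3 : Real.exp (-(3 * t)) < 1 := by rw [Real.exp_lt_one_iff]; linarith
  unfold cubF
  apply mul_pos hq
  nlinarith

lemma cub_exists {w : ℝ} (hw : 0 ≤ w) : ∃ x : ℝ, 1 ≤ x ∧ x ^ 3 - x ^ 2 = w := by
  have hc : ContinuousOn (fun x : ℝ => x ^ 3 - x ^ 2) (Set.Icc 1 (1 + w)) := by fun_prop
  have := intermediate_value_Icc (by linarith : (1 : ℝ) ≤ 1 + w) hc
  have hm : w ∈ Set.Icc ((1 : ℝ) ^ 3 - 1 ^ 2) ((1 + w) ^ 3 - (1 + w) ^ 2) := by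
    constructor
    · norm_num; exact hw
    · nlinarith [mul_nonneg hw hw, mul_nonneg (mul_nonneg hw hw) hw]
  obtain ⟨x, hx, hx2⟩ := this hm
  exact ⟨x, hx.1, hx2⟩

lemma cub_ge_one {w x : ℝ} (hw : 0 ≤ w) (hx : 0 < x) (h : x ^ 3 - x ^ 2 = w) : 1 ≤ x := by
  by_contra hlt
  push Not at hlt
  have : x ^ 2 * (x - 1) < 0 := mul_neg_of_pos_of_neg (by positivity) (by linarith)
  nlinarith

lemma cub_le {x y a b : ℝ} (hx : 1 ≤ x) (hy : 1 ≤ y) (h : x ^ 3 - x ^ 2 = a)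
    (h' : y ^ 3 - y ^ 2 = b) : |x - y| ≤ |a - b| := by
  have : a - b = (x - y) * (x ^ 2 + x * y + y ^ 2 - x - y) := by rw [← h, ← h']; ring
  rw [this, abs_mul]
  have h1 : 1 ≤ x ^ 2 + x * y + y ^ 2 - x - y := by nlinarith
  have h2 : 1 ≤ |x ^ 2 + x * y + y ^ 2 - x - y| := h1.trans (le_abs_self _)
  nlinarith [abs_nonneg (x - y)]

lemma cubicRoot_spec {q : ℝ} (hq : 0 < q) (t : ℝ) :
    1 ≤ cubicRoot q t ∧ cubicRoot q t ^ 3 - cubicRoot q t ^ 2 = cubF q t := by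
  obtain ⟨x, hx, hx2⟩ := cub_exists (cubF_nonneg hq t)
  have : {x : ℝ | 0 < x ∧ x ^ 3 - x ^ 2 = q * (Real.exp (3 * t) + Real.exp (-(3 * t)) - 2)}
      = {x} := by
    ext y
    simp only [Set.mem_ofPred_eq, Set.mem_singleton_iff]
    constructor
    · rintro ⟨h1, h2⟩
      have h2 : y ^ 3 - y ^ 2 = cubF q t := h2
      have := cub_le (cub_ge_one (cubF_nonneg hq t) h1 h2) hx h2 hx2
      simp only [sub_self, abs_zero] at this
      have := abs_nonpos_iff.1 this
      linarith
    · rintro rfl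
      exact ⟨by linarith, hx2⟩
  unfold cubicRoot
  rw [this, csSup_singleton]
  exact ⟨hx, hx2⟩

lemma cubicRoot_le_of {q : ℝ} (hq : 0 < q) (t : ℝ) {y : ℝ} (hy : 1 ≤ y)
    (h : cubF q t ≤ y ^ 3 - y ^ 2) : cubicRoot q t ≤ y := by
  obtain ⟨h1, h2⟩ := cubicRoot_spec hq t
  by_contra hlt
  push Not at hlt
  nlinarith [mul_pos (sub_pos.2 hlt) (show 0 < cubicRoot q t ^ 2 + cubicRoot q t * y + y ^ 2 - cubicRoot q t - y by nlinarith)]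

lemma lt_cubicRoot_of {q : ℝ} (hq : 0 < q) (t : ℝ) {y : ℝ} (hy : 1 ≤ y)
    (h : y ^ 3 - y ^ 2 < cubF q t) : y < cubicRoot q t := by
  obtain ⟨h1, h2⟩ := cubicRoot_spec hq t
  by_contra hlt
  push Not at hlt
  nlinarith [mul_nonneg (sub_nonneg.2 hlt) (show 0 ≤ cubicRoot q t ^ 2 + cubicRoot q t * y + y ^ 2 - cubicRoot q t - y by nlinarith)]

lemma continuous_cubF (q : ℝ) : Continuous (cubF q) := by unfold cubF; fun_prop

lemma continuous_cubF' (q : ℝ) : Continuous (cubF' q) := by unfold cubF'; fun_prop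

lemma hasDerivAt_cubF (q t : ℝ) : HasDerivAt (cubF q) (cubF' q t) t := by
  have h1 : HasDerivAt (fun t : ℝ => Real.exp (3 * t)) (Real.exp (3 * t) * (3 * 1)) t :=
    ((hasDerivAt_id t).const_mul 3).exp
  have h2 : HasDerivAt (fun t : ℝ => Real.exp (-(3 * t))) (Real.exp (-(3 * t)) * (-(3 * 1))) t :=
    ((hasDerivAt_id t).const_mul 3).neg.exp
  have := ((h1.add h2).sub_const 2).const_mul q
  refine this.congr_deriv ?_
  unfold cubF'; ring

lemma continuous_cubicRoot {q : ℝ} (hq : 0 < q) : Continuous (cubicRoot q) := by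
  rw [continuous_iff_continuousAt]
  intro t
  rw [ContinuousAt, tendsto_iff_dist_tendsto_zero]
  have h0 : Tendsto (fun s => |cubF q s - cubF q t|) (nhds t) (nhds 0) := by
    have := ((continuous_cubF q).sub (continuous_const (y := cubF q t))).abs.tendsto t
    simpa using this
  refine squeeze_zero (fun _ => dist_nonneg) (fun s => ?_) h0
  rw [Real.dist_eq]
  exact cub_le (cubicRoot_spec hq s).1 (cubicRoot_spec hq t).1 (cubicRoot_spec hq s).2
    (cubicRoot_spec hq t).2

lemma hasDerivAt_cubicRoot {q : ℝ} (hq : 0 < q) (t : ℝ) :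
    HasDerivAt (cubicRoot q)
      (cubF' q t / (3 * cubicRoot q t ^ 2 - 2 * cubicRoot q t)) t := by
  rw [hasDerivAt_iff_tendsto_slope]
  have h1 := hasDerivAt_iff_tendsto_slope.1 (hasDerivAt_cubF q t)
  set R : ℝ → ℝ := fun s => cubicRoot q s ^ 2 + cubicRoot q s * cubicRoot q t
    + cubicRoot q t ^ 2 - cubicRoot q s - cubicRoot q t with hR
  have hRc : Continuous R := by
    have := continuous_cubicRoot hq
    fun_prop
  have hRt : R t = 3 * cubicRoot q t ^ 2 - 2 * cubicRoot q t := by simp only [hR]; ring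
  have hRpos : ∀ s, 0 < R s := by
    intro s
    have a := (cubicRoot_spec hq s).1
    have b := (cubicRoot_spec hq t).1
    simp only [hR]; nlinarith
  have h2 : Tendsto R (nhdsWithin t {t}ᶜ) (nhds (R t)) :=
    (hRc.tendsto t).mono_left nhdsWithin_le_nhds
  have h3 := h1.div h2 (hRpos t).ne'
  rw [← hRt]
  refine h3.congr' ?_
  filter_upwards [self_mem_nhdsWithin] with s hs
  have hs' : s - t ≠ 0 := sub_ne_zero.2 hs
  simp only [slope, vsub_eq_sub, smul_eq_mul, Pi.div_apply]
  have e : cubF q s - cubF q t = (cubicRoot q s - cubicRoot q t) * R s := by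
    rw [← (cubicRoot_spec hq s).2, ← (cubicRoot_spec hq t).2]; simp only [hR]; ring
  rw [e]
  have := (hRpos s).ne'
  field_simp

/-- derivative of `Λ` -/
def cubD (q t : ℝ) : ℝ := cubF' q t / (3 * cubF q t + cubicRoot q t ^ 2)

lemma cubD_den {q : ℝ} (hq : 0 < q) (t : ℝ) : 0 < 3 * cubF q t + cubicRoot q t ^ 2 := by
  have := cubF_nonneg hq t
  have := (cubicRoot_spec hq t).1
  positivity

lemma hasDerivAt_LambdaCCA {q : ℝ} (hq : 0 < q) (t : ℝ) :
    HasDerivAt (LambdaCCA q) (cubD q t) t := by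
  have h1 := (cubicRoot_spec hq t).1
  have h := (hasDerivAt_cubicRoot hq t).log (by linarith)
  refine h.congr_deriv ?_
  unfold cubD
  rw [← (cubicRoot_spec hq t).2]
  have : 0 < 3 * cubicRoot q t - 2 := by linarith
  have e1 : 3 * cubicRoot q t ^ 2 - 2 * cubicRoot q t = cubicRoot q t * (3 * cubicRoot q t - 2) := by
    ring
  have e2 : 3 * (cubicRoot q t ^ 3 - cubicRoot q t ^ 2) + cubicRoot q t ^ 2
    = cubicRoot q t ^ 2 * (3 * cubicRoot q t - 2) := by ring
  rw [e1, e2]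
  field_simp

lemma continuous_LambdaCCA {q : ℝ} (hq : 0 < q) : Continuous (LambdaCCA q) := by
  rw [continuous_iff_continuousAt]
  exact fun t => (hasDerivAt_LambdaCCA hq t).continuousAt

lemma continuous_cubD {q : ℝ} (hq : 0 < q) : Continuous (cubD q) := by
  unfold cubD
  have := continuous_cubicRoot hq
  refine (continuous_cubF' q).div ?_ (fun t => (cubD_den hq t).ne')
  have := continuous_cubF q
  fun_prop

lemma cubicRoot_zero {q : ℝ} (hq : 0 < q) : cubicRoot q 0 = 1 := by
  obtain ⟨h1, h2⟩ := cubicRoot_spec hq 0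
  have h3 := cub_le h1 le_rfl h2 (show (1 : ℝ) ^ 3 - 1 ^ 2 = 0 by norm_num)
  have h4 : cubF q 0 = 0 := by simp [cubF]; norm_num
  rw [h4] at h3
  simp only [sub_self, abs_zero] at h3
  linarith [abs_nonpos_iff.1 h3]

lemma LambdaCCA_zero {q : ℝ} (hq : 0 < q) : LambdaCCA q 0 = 0 := by
  simp [LambdaCCA, cubicRoot_zero hq]

lemma cubD_le_one {q : ℝ} (hq : 0 < q) (hq' : q ≤ 1 / 27) (t : ℝ) : cubD q t ≤ 1 := by
  unfold cubD
  rw [div_le_one (cubD_den hq t)]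
  have h1 := (cubicRoot_spec hq t).1
  have h2 := Real.exp_pos (-(3 * t))
  unfold cubF' cubF
  nlinarith [mul_pos hq h2]

lemma exp_three (t : ℝ) : Real.exp (3 * t) = Real.exp t ^ 3 := by
  rw [← Real.exp_nat_mul]; norm_num

lemma cubicRoot_le_exp {q : ℝ} (hq : 0 < q) (hq' : q ≤ 1 / 27) {t : ℝ} (ht : 0 ≤ t) :
    cubicRoot q t ≤ Real.exp t := by
  have h1 : 1 ≤ Real.exp t := Real.one_le_exp ht
  refine cubicRoot_le_of hq t h1 ?_
  unfold cubF
  rw [exp_three]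
  have h2 : Real.exp (-(3 * t)) ≤ 1 := by rw [Real.exp_le_one_iff]; linarith
  set y := Real.exp t
  have h3 : 1 ≤ y ^ 3 := one_le_pow₀ h1
  have : q * (y ^ 3 + Real.exp (-(3 * t)) - 2) ≤ 1 / 27 * (y ^ 3 - 1) := by
    calc _ ≤ q * (y ^ 3 - 1) := by apply mul_le_mul_of_nonneg_left _ hq.le; linarith
      _ ≤ _ := by apply mul_le_mul_of_nonneg_right hq'; linarith
  nlinarith [mul_nonneg (sub_nonneg.2 h1) (sub_nonneg.2 h1), mul_nonneg (sub_nonneg.2 h1) (sq_nonneg y)]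

lemma tendsto_F_exp (q : ℝ) :
    Tendsto (fun t => cubF q t * Real.exp (-(3 * t))) atTop (nhds q) := by
  have h0 : Tendsto (fun t : ℝ => Real.exp (-(3 * t))) atTop (nhds 0) := by
    apply Real.tendsto_exp_neg_atTop_nhds_zero.comp
    exact tendsto_id.const_mul_atTop (by norm_num : (0:ℝ) < 3)
  have : Tendsto (fun t : ℝ => q * (1 + Real.exp (-(3 * t)) * Real.exp (-(3 * t))
      - 2 * Real.exp (-(3 * t)))) atTop (nhds (q * (1 + 0 * 0 - 2 * 0))) :=
    (((h0.mul h0).const_add 1).sub (h0.const_mul 2)).const_mul q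
  simp only [mul_zero, add_zero, sub_zero, mul_one] at this
  refine this.congr fun t => ?_
  unfold cubF
  linear_combination (-q) * exp_mul_neg3 t

lemma tendsto_F'_exp (q : ℝ) :
    Tendsto (fun t => cubF' q t * Real.exp (-(3 * t))) atTop (nhds (3 * q)) := by
  have h0 : Tendsto (fun t : ℝ => Real.exp (-(3 * t))) atTop (nhds 0) := by
    apply Real.tendsto_exp_neg_atTop_nhds_zero.comp
    exact tendsto_id.const_mul_atTop (by norm_num : (0:ℝ) < 3)
  have : Tendsto (fun t : ℝ => 3 * q * (1 - Real.exp (-(3 * t)) * Real.exp (-(3 * t))))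
      atTop (nhds (3 * q * (1 - 0 * 0))) :=
    ((h0.mul h0).const_sub 1).const_mul (3 * q)
  simp only [mul_zero, sub_zero, mul_one] at this
  refine this.congr fun t => ?_
  unfold cubF'
  linear_combination (-3 * q) * exp_mul_neg3 t

lemma tendsto_x2_exp {q : ℝ} (hq : 0 < q) (hq' : q ≤ 1 / 27) :
    Tendsto (fun t => cubicRoot q t ^ 2 * Real.exp (-(3 * t))) atTop (nhds 0) := by
  refine squeeze_zero' (Eventually.of_forall fun t => by positivity) ?_
    Real.tendsto_exp_neg_atTop_nhds_zero
  filter_upwards [eventually_ge_atTop 0] with t ht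
  have h := cubicRoot_le_exp hq hq' ht
  have h1 := (cubicRoot_spec hq t).1
  calc _ ≤ Real.exp t ^ 2 * Real.exp (-(3 * t)) := by gcongr
    _ = _ := by rw [← Real.exp_nat_mul, ← Real.exp_add]; congr 1; push_cast; ring

lemma tendsto_cubD {q : ℝ} (hq : 0 < q) (hq' : q ≤ 1 / 27) :
    Tendsto (cubD q) atTop (nhds 1) := by
  have h := (tendsto_F'_exp q).div (((tendsto_F_exp q).const_mul 3).add (tendsto_x2_exp hq hq'))
    (by positivity)
  rw [add_zero, div_self (by positivity)] at h
  refine h.congr fun t => ?_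
  have := Real.exp_pos (-(3 * t))
  simp only [Pi.div_apply]
  unfold cubD
  rw [← mul_assoc, ← add_mul, mul_div_mul_right _ _ this.ne']

lemma tendsto_id_sub_Lambda {q : ℝ} (hq : 0 < q) (hq' : q ≤ 1 / 27) :
    Tendsto (fun t => t - LambdaCCA q t) atTop (nhds (-(1 / 3) * Real.log q)) := by
  have h := (tendsto_x2_exp hq hq').add (tendsto_F_exp q)
  rw [zero_add] at h
  have h' := (((Real.continuousAt_log hq.ne').tendsto.comp h).const_mul (-(1/3)))
  refine h'.congr fun t => ?_
  obtain ⟨h1, h2⟩ := cubicRoot_spec hq t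
  have e : cubicRoot q t ^ 2 * Real.exp (-(3 * t)) + cubF q t * Real.exp (-(3 * t))
      = cubicRoot q t ^ 3 * Real.exp (-(3 * t)) := by rw [← h2]; ring
  simp only [Function.comp]
  rw [e, Real.log_mul (by positivity) (by positivity), Real.log_exp, Real.log_pow]
  unfold LambdaCCA
  push_cast; ring

lemma id_sub_Lambda_lt {q : ℝ} (hq : 0 < q) (hq' : q ≤ 1 / 27) {t : ℝ} (ht : 0 < t) :
    t - LambdaCCA q t < -(1 / 3) * Real.log q := by
  obtain ⟨h1, h2⟩ := cubicRoot_spec hq t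
  have key : q ^ (1 / 3 : ℝ) * Real.exp t < cubicRoot q t := by
    set y := q ^ (1 / 3 : ℝ) * Real.exp t with hy
    have hy3 : y ^ 3 = q * Real.exp (3 * t) := by
      rw [hy, mul_pow, ← Real.rpow_natCast, ← Real.rpow_mul hq.le, exp_three]; norm_num
    rcases le_or_gt y 1 with h | h
    · refine lt_of_le_of_lt h (lt_cubicRoot_of hq t le_rfl ?_)
      simpa using cubF_pos hq ht
    · refine lt_cubicRoot_of hq t h.le ?_
      rw [hy3]
      unfold cubF
      have := Real.exp_pos (-(3 * t))
      nlinarith [mul_pos hq this]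
  have h3 : Real.log (q ^ (1 / 3 : ℝ) * Real.exp t) < LambdaCCA q t :=
    Real.log_lt_log (by positivity) key
  rw [Real.log_mul (by positivity) (by positivity), Real.log_exp, Real.log_rpow hq] at h3
  linarith

/-- the rate function along the tilt -/
def cubJ (q t : ℝ) : ℝ := t * cubD q t - LambdaCCA q t

lemma continuous_cubJ {q : ℝ} (hq : 0 < q) : Continuous (cubJ q) := by
  have := continuous_cubD hq
  have := continuous_LambdaCCA hq
  unfold cubJ; fun_prop

lemma cubJ_zero {q : ℝ} (hq : 0 < q) : cubJ q 0 = 0 := by simp [cubJ, LambdaCCA_zero hq]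

lemma cubJ_lt {q : ℝ} (hq : 0 < q) (hq' : q ≤ 1 / 27) {t : ℝ} (ht : 0 < t) :
    cubJ q t < -(1 / 3) * Real.log q := by
  have h1 := id_sub_Lambda_lt hq hq' ht
  have h2 := cubD_le_one hq hq' t
  unfold cubJ
  nlinarith

/-- Deterministic conclusion. -/
lemma deterministic_conclusion {q : ℝ} (hq : 0 < q) (hq' : q ≤ 1 / 27) {H v : ℝ} (hH : 0 ≤ H)
    (hv1 : v ≤ 1)
    (hup : ∀ t : ℚ, 0 < (t : ℝ) → t * v ≤ LambdaCCA q t + H)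
    (hlow : ∀ t : ℚ, 0 < (t : ℝ) → cubJ q t < H → cubD q t ≤ v) :
    (-(1 / 3) * Real.log q ≤ H → v = 1) ∧
    (H < -(1 / 3) * Real.log q → v < 1 ∧ LstarCCA q v = (H : EReal)) := by
  have hup' : ∀ t : ℝ, 0 < t → t * v ≤ LambdaCCA q t + H := by
    intro t ht
    by_contra hlt
    push Not at hlt
    have ho : IsOpen ({s : ℝ | 0 < s} ∩ {s : ℝ | LambdaCCA q s + H < s * v}) := by
      refine (isOpen_lt continuous_const continuous_id).inter (isOpen_lt ?_ ?_)
      · exact (continuous_LambdaCCA hq).add continuous_const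
      · exact continuous_id.mul continuous_const
    obtain ⟨s, hs⟩ := Rat.isDenseEmbedding_coe_real.dense.exists_mem_open ho ⟨t, ht, hlt⟩
    have := hup s hs.1
    have : LambdaCCA q s + H < s * v := hs.2
    linarith
  have hlow' : ∀ t : ℝ, 0 < t → cubJ q t < H → cubD q t ≤ v := by
    intro t ht hJ
    by_contra hlt
    push Not at hlt
    have ho : IsOpen (({s : ℝ | 0 < s} ∩ {s : ℝ | cubJ q s < H}) ∩ {s : ℝ | v < cubD q s}) := by
      refine ((isOpen_lt continuous_const continuous_id).inter (isOpen_lt ?_ ?_)).inter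
        (isOpen_lt ?_ ?_)
      · exact (continuous_cubJ hq)
      · exact continuous_const
      · exact continuous_const
      · exact continuous_cubD hq
    obtain ⟨s, hs⟩ := Rat.isDenseEmbedding_coe_real.dense.exists_mem_open ho ⟨t, ⟨ht, hJ⟩, hlt⟩
    have := hlow s hs.1.1 hs.1.2
    have : v < cubD q s := hs.2
    linarith
  have hall : (∀ t : ℝ, 0 < t → cubJ q t < H) → 1 ≤ v := by
    intro h
    refine le_of_tendsto (tendsto_cubD hq hq') ?_
    filter_upwards [eventually_gt_atTop 0] with t ht
    exact hlow' t ht (h t ht)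
  refine ⟨fun h => le_antisymm hv1 (hall fun t ht => (cubJ_lt hq hq' ht).trans_le h), fun h => ?_⟩
  have hlt : v < 1 := by
    have h1 := (tendsto_id_sub_Lambda hq hq').eventually_const_lt h
    obtain ⟨t, ht, ht0⟩ := (h1.and (eventually_gt_atTop 0)).exists
    have := hup' t ht0
    by_contra hv
    push Not at hv
    nlinarith
  refine ⟨hlt, le_antisymm ?_ ?_⟩
  · unfold LstarCCA
    refine iSup_le fun t => ?_
    rw [EReal.coe_le_coe_iff]
    rcases (show (0 : ℝ) ≤ t.1 from t.2).eq_or_lt with h0 | h0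
    · rw [← h0, LambdaCCA_zero hq]; simpa using hH
    · have := hup' t.1 h0
      linarith
  · have hex : ∃ t : ℝ, 0 < t ∧ H ≤ cubJ q t := by
      by_contra hne
      push Not at hne
      linarith [hall hne]
    obtain ⟨t1, ht1, hJ1⟩ := hex
    -- first point where J ≥ H
    set A : Set ℝ := Set.Icc 0 t1 ∩ {t | H ≤ cubJ q t} with hA
    have hAc : IsCompact A :=
      isCompact_Icc.inter_right (isClosed_le continuous_const (continuous_cubJ hq))
    obtain ⟨t, htA, htmin⟩ := hAc.exists_isLeast ⟨t1, ⟨ht1.le, le_rfl⟩, hJ1⟩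
    have hval : H ≤ t * v - LambdaCCA q t := by
      rcases htA.1.1.eq_or_lt with h0 | h0
      · have h2 : H ≤ cubJ q t := htA.2
        rw [← h0, cubJ_zero hq] at h2
        rw [← h0, LambdaCCA_zero hq]; simpa using h2
      · have hD : cubD q t ≤ v := by
          have hl : Tendsto (cubD q) (nhdsWithin t (Set.Iio t)) (nhds (cubD q t)) :=
            ((continuous_cubD hq).tendsto t).mono_left nhdsWithin_le_nhds
          refine le_of_tendsto hl ?_
          filter_upwards [Ioo_mem_nhdsLT h0] with s hs
          refine hlow' s hs.1 ?_
          by_contra hcon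
          push Not at hcon
          have := htmin (show s ∈ A from ⟨⟨hs.1.le, hs.2.le.trans htA.1.2⟩, hcon⟩)
          linarith [hs.2]
        have h2 : H ≤ cubJ q t := htA.2
        unfold cubJ at h2
        nlinarith
    unfold LstarCCA
    exact le_iSup_of_le (⟨t, htA.1.1⟩ : Set.Ici (0 : ℝ)) (EReal.coe_le_coe_iff.2 (by
      show H ≤ v * t - LambdaCCA q t
      linarith))

/-! ### Part B: the transfer operator and the large deviation lower bound -/

lemma sum_zmod3 {M : Type*} [AddCommMonoid M] (f : ZMod 3 → M) :
    ∑ j : ZMod 3, f j = f 0 + f 1 + f 2 := Fin.sum_univ_three f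

lemma zmod3_cases (i : ZMod 3) : i = 0 ∨ i = 1 ∨ i = 2 := by
  revert i; decide

lemma repInt_zero : ZMod.repInt 0 = 0 := by simp [ZMod.repInt]
lemma repInt_one : ZMod.repInt 1 = 1 := by
  have : (1 : ZMod 3) ≠ 0 := by decide
  simp [ZMod.repInt]
lemma repInt_two : ZMod.repInt 2 = -1 := by
  have h1 : (2 : ZMod 3) ≠ 0 := by decide
  have h2 : (2 : ZMod 3) ≠ 1 := by decide
  simp [ZMod.repInt, h1, h2]

lemma repInt_abs (a : ZMod 3) : |(ZMod.repInt a : ℝ)| ≤ 1 := by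
  rcases zmod3_cases a with rfl | rfl | rfl
  · simp [repInt_zero]
  · simp [repInt_one]
  · simp [repInt_two]

lemma exists_eigenvector (p : ZMod 3 → ℝ) (hp : ∀ i, 0 < p i) (hsum : p 0 + p 1 + p 2 = 1)
    (t : ℝ) : ∃ v : ZMod 3 → ℝ, (∀ i, 0 < v i) ∧ ∀ i,
      ∑ j, p j * (Real.exp (t * (ZMod.repInt (j - i) : ℝ)) * v j)
        = cubicRoot (p 0 * p 1 * p 2) t * v i := by
  have hq : 0 < p 0 * p 1 * p 2 := mul_pos (mul_pos (hp 0) (hp 1)) (hp 2)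
  obtain ⟨h1, h2⟩ := cubicRoot_spec hq t
  set x := cubicRoot (p 0 * p 1 * p 2) t
  have ha : 0 < Real.exp t := Real.exp_pos t
  set a := Real.exp t with hadef
  set b := Real.exp (-t) with hbdef
  have hb : 0 < b := Real.exp_pos _
  have hab : a * b = 1 := by rw [hadef, hbdef, ← Real.exp_add]; simp
  have hF : x ^ 3 - x ^ 2 = p 0 * p 1 * p 2 * (a ^ 3 + b ^ 3 - 2) := by
    rw [h2]; unfold cubF
    rw [exp_three, show -(3 * t) = 3 * (-t) by ring, exp_three]
  have h0 := hp 0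
  have h1' := hp 1
  have h2' := hp 2
  have z10 : (1 : ZMod 3) ≠ 0 := by decide
  have z20 : (2 : ZMod 3) ≠ 0 := by decide
  have z21 : (2 : ZMod 3) ≠ 1 := by decide
  have d01 : (0 : ZMod 3) - 1 = 2 := by decide
  have d02 : (0 : ZMod 3) - 2 = 1 := by decide
  have d12 : (1 : ZMod 3) - 2 = 2 := by decide
  have d21 : (2 : ZMod 3) - 1 = 1 := by decide
  refine ⟨fun i => if i = 0 then x * (x - p 1 - p 2) else if i = 1 then
    p 0 * (b * (x - p 2) + p 2 * a ^ 2) else p 0 * (a * (x - p 1) + p 1 * b ^ 2), ?_, ?_⟩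
  · intro i
    rcases zmod3_cases i with rfl | rfl | rfl
    · simp only [if_true]
      apply mul_pos <;> linarith
    · simp only [z10, if_false, if_true]
      have : 0 < x - p 2 := by linarith
      positivity
    · simp only [z20, z21, if_false]
      have : 0 < x - p 1 := by linarith
      positivity
  · intro i
    rw [sum_zmod3]
    have ep : p 2 = 1 - p 0 - p 1 := by linarith
    rcases zmod3_cases i with rfl | rfl | rfl
    · simp only [sub_zero, sub_self, repInt_zero, repInt_one, repInt_two, z10, z20, z21, if_true,
        if_false, Int.cast_zero, Int.cast_one, Int.cast_neg, mul_zero, mul_one, mul_neg,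
        Real.exp_zero, one_mul, ← hadef, ← hbdef]
      linear_combination (-1) * hF + x ^ 2 * hsum + p 0 * p 1 * (x - p 2) * hab + p 0 * p 2 * (x - p 1) * hab
    · simp only [sub_self, d01, d21, repInt_zero, repInt_one, repInt_two, z10, z20, z21, if_true,
        if_false, Int.cast_zero, Int.cast_one, Int.cast_neg, mul_zero, mul_one, mul_neg,
        Real.exp_zero, one_mul, ← hadef, ← hbdef]
      linear_combination p 0 * p 1 * p 2 * b * hab 
    · simp only [sub_self, d02, d12, repInt_zero, repInt_one, repInt_two, z10, z20, z21, if_true,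
        if_false, Int.cast_zero, Int.cast_one, Int.cast_neg, mul_zero, mul_one, mul_neg,
        Real.exp_zero, one_mul, ← hadef, ← hbdef]
      linear_combination p 0 * p 1 * p 2 * a * hab

/-- The transfer operator with drift `u`. -/
def opA (p : ZMod 3 → ℝ) (u : ℝ) : (ℝ → ZMod 3 → ℝ) →ₗ[ℝ] (ℝ → ZMod 3 → ℝ) where
  toFun h := fun s i => ∑ j, p j * h (s + (ZMod.repInt (j - i) : ℝ) - u) j
  map_add' h h' := by
    funext s i
    simp only [Pi.add_apply, mul_add, Finset.sum_add_distrib]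
  map_smul' c h := by
    funext s i
    simp only [Pi.smul_apply, smul_eq_mul, Finset.mul_sum, RingHom.id_apply]
    exact Finset.sum_congr rfl fun j _ => by ring

lemma opA_apply (p : ZMod 3 → ℝ) (u : ℝ) (h : ℝ → ZMod 3 → ℝ) (s : ℝ) (i : ZMod 3) :
    opA p u h s i = ∑ j, p j * h (s + (ZMod.repInt (j - i) : ℝ) - u) j := rfl

lemma opA_mono {p : ZMod 3 → ℝ} (hp : ∀ i, 0 < p i) (u : ℝ) {h h' : ℝ → ZMod 3 → ℝ}
    (hh : ∀ s i, h s i ≤ h' s i) (s : ℝ) (i : ZMod 3) : opA p u h s i ≤ opA p u h' s i := by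
  rw [opA_apply, opA_apply]
  exact Finset.sum_le_sum fun j _ => mul_le_mul_of_nonneg_left (hh _ _) (hp j).le

lemma opA_pow_succ (p : ZMod 3 → ℝ) (u : ℝ) (h : ℝ → ZMod 3 → ℝ) (k : ℕ) :
    (opA p u ^ (k + 1)) h = opA p u ((opA p u ^ k) h) := by
  rw [pow_succ']; rfl

lemma opA_pow_mono {p : ZMod 3 → ℝ} (hp : ∀ i, 0 < p i) (u : ℝ) {h h' : ℝ → ZMod 3 → ℝ}
    (hh : ∀ s i, h s i ≤ h' s i) (k : ℕ) (s : ℝ) (i : ZMod 3) :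
    (opA p u ^ k) h s i ≤ (opA p u ^ k) h' s i := by
  induction k generalizing s i with
  | zero => exact hh s i
  | succ k ih =>
    rw [opA_pow_succ, opA_pow_succ]
    exact opA_mono hp u ih s i

lemma opA_pow_monoS {p : ZMod 3 → ℝ} (hp : ∀ i, 0 < p i) (u : ℝ) {h : ℝ → ZMod 3 → ℝ}
    (hh : ∀ s s' i, s ≤ s' → h s i ≤ h s' i) (k : ℕ) (s s' : ℝ) (i : ZMod 3) (hs : s ≤ s') :
    (opA p u ^ k) h s i ≤ (opA p u ^ k) h s' i := by
  induction k generalizing s s' i with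
  | zero => exact hh s s' i hs
  | succ k ih =>
    rw [opA_pow_succ, opA_apply, opA_apply]
    exact Finset.sum_le_sum fun j _ => mul_le_mul_of_nonneg_left
      (ih _ _ _ (by linarith)) (hp j).le

lemma opA_pow_eigen (p : ZMod 3 → ℝ) (u t x : ℝ) (v : ZMod 3 → ℝ)
    (hv : ∀ i, ∑ j, p j * (Real.exp (t * (ZMod.repInt (j - i) : ℝ)) * v j) = x * v i)
    (k : ℕ) (s : ℝ) (i : ZMod 3) :
    (opA p u ^ k) (fun s i => Real.exp (t * s) * v i) s i
      = (x * Real.exp (-(t * u))) ^ k * (Real.exp (t * s) * v i) := by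
  induction k generalizing s i with
  | zero => simp
  | succ k ih =>
    rw [opA_pow_succ, opA_apply]
    simp only [ih]
    have : ∀ j, p j * ((x * Real.exp (-(t * u))) ^ k *
        (Real.exp (t * (s + (ZMod.repInt (j - i) : ℝ) - u)) * v j))
        = (x * Real.exp (-(t * u))) ^ k * Real.exp (t * s) * Real.exp (-(t * u)) *
          (p j * (Real.exp (t * (ZMod.repInt (j - i) : ℝ)) * v j)) := by
      intro j
      rw [show t * (s + (ZMod.repInt (j - i) : ℝ) - u)
        = t * s + t * (ZMod.repInt (j - i) : ℝ) + -(t * u) by ring, Real.exp_add, Real.exp_add]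
      ring
    simp only [this]
    rw [← Finset.mul_sum, hv, pow_succ]
    ring

/-- indicator of the half-line -/
def halfInd : ℝ → ZMod 3 → ℝ := fun s _ => if 0 ≤ s then 1 else 0

lemma halfInd_nonneg (s : ℝ) (i : ZMod 3) : 0 ≤ halfInd s i := by
  unfold halfInd; split_ifs <;> norm_num

lemma halfInd_le (s : ℝ) (i : ZMod 3) : halfInd s i ≤ 1 := by
  unfold halfInd; split_ifs <;> norm_num

lemma halfInd_mono (s s' : ℝ) (i : ZMod 3) (h : s ≤ s') : halfInd s i ≤ halfInd s' i := by
  unfold halfInd; split_ifs <;> first | (exfalso; linarith) | norm_num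

lemma pointwise_exp {t η d s : ℝ} (ht : 0 < t) (hη : 0 < η) (i : ZMod 3) :
    Real.exp (t * s) ≤ Real.exp (t * d) * halfInd s i + Real.exp ((t + η) * s) * Real.exp (-(η * d))
      + Real.exp ((t - η) * s) := by
  have e1 := Real.exp_pos (t * d)
  have e2 := Real.exp_pos ((t + η) * s)
  have e3 := Real.exp_pos (-(η * d))
  have e4 := Real.exp_pos ((t - η) * s)
  have e5 := mul_pos e2 e3
  rcases lt_or_ge s 0 with h | h
  · have : Real.exp (t * s) ≤ Real.exp ((t - η) * s) := Real.exp_le_exp.2 (by nlinarith)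
    have := mul_nonneg e1.le (halfInd_nonneg s i)
    linarith
  · have hf : halfInd s i = 1 := by simp [halfInd, h]
    rw [hf, mul_one]
    rcases le_or_gt s d with h' | h'
    · have : Real.exp (t * s) ≤ Real.exp (t * d) := Real.exp_le_exp.2 (by nlinarith)
      linarith
    · have : Real.exp (t * s) ≤ Real.exp ((t + η) * s) * Real.exp (-(η * d)) := by
        rw [← Real.exp_add]; exact Real.exp_le_exp.2 (by nlinarith)
      linarith

lemma exists_eta {q : ℝ} (hq : 0 < q) {t δ : ℝ} (hδ : 0 < δ) :
    ∃ η > 0, LambdaCCA q (t + η) - LambdaCCA q t < η * (cubD q t + δ) ∧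
      LambdaCCA q (t - η) - LambdaCCA q t < -(η * (cubD q t - δ)) := by
  have h := hasDerivAt_iff_isLittleO.1 (hasDerivAt_LambdaCCA hq t)
  have h1 := h.bound (half_pos hδ)
  rw [Metric.eventually_nhds_iff] at h1
  obtain ⟨ε, hε, h2⟩ := h1
  refine ⟨ε / 2, by positivity, ?_, ?_⟩
  · have := h2 (y := t + ε / 2) (by rw [Real.dist_eq]; rw [abs_of_pos] <;> linarith)
    simp only [add_sub_cancel_left, smul_eq_mul, Real.norm_eq_abs, abs_of_pos (half_pos hε)] at this
    have := (abs_le.1 this).2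
    nlinarith [mul_pos hε hδ]
  · have := h2 (y := t - ε / 2) (by rw [Real.dist_eq]; rw [abs_of_neg] <;> linarith)
    have e : t - ε / 2 - t = -(ε / 2) := by ring
    simp only [e, smul_eq_mul, Real.norm_eq_abs, abs_neg, abs_of_pos (half_pos hε)] at this
    have := (abs_le.1 this).2
    nlinarith [mul_pos hε hδ]

lemma cramer_lower (p : ZMod 3 → ℝ) (hp : ∀ i, 0 < p i) (hsum : p 0 + p 1 + p 2 = 1)
    {t L δ : ℝ} (ht : 0 < t) (hδ : 0 < δ) (hJ : cubJ (p 0 * p 1 * p 2) t + t * δ < L) :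
    ∃ ρ : ℝ, Real.exp (-L) < ρ ∧ ∃ k : ℕ, 1 ≤ k ∧
      ∀ i, ρ ^ k ≤ (opA p (cubD (p 0 * p 1 * p 2) t - δ) ^ k) halfInd 0 i := by
  have hq : 0 < p 0 * p 1 * p 2 := mul_pos (mul_pos (hp 0) (hp 1)) (hp 2)
  set q := p 0 * p 1 * p 2 with hqdef
  obtain ⟨η, hη, hη1, hη2⟩ := exists_eta hq (t := t) hδ
  set D := cubD q t
  set u := D - δ with hu
  obtain ⟨v, hv, hve⟩ := exists_eigenvector p hp hsum t
  obtain ⟨vp, hvp, hvpe⟩ := exists_eigenvector p hp hsum (t + η)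
  obtain ⟨vm, hvm, hvme⟩ := exists_eigenvector p hp hsum (t - η)
  rw [← hqdef] at hve hvpe hvme
  have hexpL : ∀ s, cubicRoot q s = Real.exp (LambdaCCA q s) := fun s => by
    unfold LambdaCCA; rw [Real.exp_log]; linarith [(cubicRoot_spec hq s).1]
  -- constant
  obtain ⟨C, hC0, hC⟩ : ∃ C : ℝ, 0 < C ∧ ∀ i, v i ≤ C ∧ v i ≤ C * vp i ∧ v i ≤ C * vm i := by
    refine ⟨∑ i, (v i + v i / vp i + v i / vm i), ?_, ?_⟩
    · refine Finset.sum_pos (fun i _ => ?_) Finset.univ_nonempty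
      have := hv i; have := hvp i; have := hvm i
      positivity
    · intro i
      have h1 : v i + v i / vp i + v i / vm i ≤ ∑ i, (v i + v i / vp i + v i / vm i) :=
        Finset.single_le_sum (f := fun i => v i + v i / vp i + v i / vm i) (fun i _ => by
          have := hv i; have := hvp i; have := hvm i
          positivity) (Finset.mem_univ i)
      set C := ∑ i, (v i + v i / vp i + v i / vm i)
      have a1 := hv i; have a2 := hvp i; have a3 := hvm i
      have a4 : 0 < v i / vp i := by positivity
      have a5 : 0 < v i / vm i := by positivity
      refine ⟨by linarith, ?_, ?_⟩
      · rw [← div_le_iff₀ a2]; linarith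
      · rw [← div_le_iff₀ a3]; linarith
  set θ := Real.exp (LambdaCCA q t - t * u - 2 * t * δ) with hθ
  have hθL : Real.exp (-L) < θ := by
    rw [hθ, Real.exp_lt_exp]
    unfold cubJ at hJ
    have : t * u = t * D - t * δ := by rw [hu]; ring
    have : t * cubD q t = t * D := rfl
    linarith
  obtain ⟨ρ, hρ1, hρ2⟩ := exists_between hθL
  have hρ0 : 0 < ρ := (Real.exp_pos _).trans hρ1
  refine ⟨ρ, hρ1, ?_⟩
  set a1 := Real.exp (LambdaCCA q (t + η) - LambdaCCA q t - η * (u + 2 * δ)) with ha1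
  set a2 := Real.exp (LambdaCCA q (t - η) - LambdaCCA q t + η * u) with ha2
  have ha1' : a1 < 1 := by
    rw [ha1, Real.exp_lt_one_iff]
    have : η * (u + 2 * δ) = η * (D + δ) := by rw [hu]; ring
    linarith
  have ha2' : a2 < 1 := by
    rw [ha2, Real.exp_lt_one_iff]
    linarith
  have hev : ∀ i, ∀ᶠ k : ℕ in atTop,
      0 < v i / C - a1 ^ k * vp i - a2 ^ k * vm i - (ρ / θ) ^ k := by
    intro i
    have l1 : Tendsto (fun k : ℕ => v i / C - a1 ^ k * vp i - a2 ^ k * vm i - (ρ / θ) ^ k) atTop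
        (nhds (v i / C - 0 * vp i - 0 * vm i - 0)) := by
      refine ((tendsto_const_nhds.sub ((tendsto_pow_atTop_nhds_zero_of_lt_one (Real.exp_pos _).le
        ha1').mul_const _)).sub ((tendsto_pow_atTop_nhds_zero_of_lt_one (Real.exp_pos _).le
        ha2').mul_const _)).sub (tendsto_pow_atTop_nhds_zero_of_lt_one ?_ ?_)
      · positivity
      · rw [div_lt_one (by positivity)]; exact hρ2
    refine l1.eventually_const_lt ?_
    have := hv i
    simp only [zero_mul, sub_zero]
    positivity
  obtain ⟨k, hk, hk1⟩ := ((eventually_all.2 hev).and (eventually_ge_atTop 1)).exists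
  refine ⟨k, hk1, fun i => ?_⟩
  have hk := hk i
  -- pointwise
  have hpt : ∀ s i, (fun s i => Real.exp (t * s) * v i) s i ≤
      ((C * Real.exp (t * (2 * δ * k))) • halfInd
        + (C * Real.exp (-(η * (2 * δ * k)))) • (fun s i => Real.exp ((t + η) * s) * vp i)
        + C • (fun s i => Real.exp ((t - η) * s) * vm i)) s i := by
    intro s i
    have h := pointwise_exp (s := s) (d := 2 * δ * k) ht hη i
    obtain ⟨c1, c2, c3⟩ := hC i
    simp only [Pi.add_apply, Pi.smul_apply, smul_eq_mul]
    have b1 := mul_nonneg (Real.exp_pos (t * (2 * δ * k))).le (halfInd_nonneg s i)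
    have b2 := mul_pos (Real.exp_pos ((t + η) * s)) (Real.exp_pos (-(η * (2 * δ * k))))
    have b3 := Real.exp_pos ((t - η) * s)
    have := mul_le_mul_of_nonneg_right h (hv i).le
    have d1 := mul_le_mul_of_nonneg_left c1 b1
    have d2 := mul_le_mul_of_nonneg_left c2 b2.le
    have d3 := mul_le_mul_of_nonneg_left c3 b3.le
    nlinarith
  have hop := opA_pow_mono hp u hpt k 0 i
  simp only [map_add, map_smul, Pi.add_apply, Pi.smul_apply, smul_eq_mul] at hop
  rw [opA_pow_eigen p u t _ v hve, opA_pow_eigen p u _ _ vp hvpe, opA_pow_eigen p u _ _ vm hvme]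
    at hop
  simp only [mul_zero, Real.exp_zero, one_mul] at hop
  set Y := (opA p u ^ k) halfInd 0 i
  set X := Real.exp (LambdaCCA q t - t * u) with hX
  have hXpos : 0 < X ^ k := by positivity
  have e0 : cubicRoot q t * Real.exp (-(t * u)) = X := by
    rw [hexpL, ← Real.exp_add, hX]; congr 1
  have e1 : Real.exp (-(η * (2 * δ * k))) *
      (cubicRoot q (t + η) * Real.exp (-((t + η) * u))) ^ k = X ^ k * a1 ^ k := by
    rw [hexpL, ← Real.exp_add, hX, ha1, ← Real.exp_nat_mul, ← Real.exp_nat_mul,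
      ← Real.exp_nat_mul, ← Real.exp_add, ← Real.exp_add]
    congr 1; ring
  have e2 : (cubicRoot q (t - η) * Real.exp (-((t - η) * u))) ^ k = X ^ k * a2 ^ k := by
    rw [hexpL, ← Real.exp_add, hX, ha2, ← Real.exp_nat_mul, ← Real.exp_nat_mul,
      ← Real.exp_nat_mul, ← Real.exp_add]
    congr 1; ring
  have e3 : X ^ k = Real.exp (t * (2 * δ * k)) * θ ^ k := by
    rw [hX, hθ, ← Real.exp_nat_mul, ← Real.exp_nat_mul, ← Real.exp_add]
    congr 1; ring
  rw [e0, e2] at hop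
  have hop2 : X ^ k * v i ≤ C * Real.exp (t * (2 * δ * k)) * Y + C * (X ^ k * a1 ^ k * vp i)
      + C * (X ^ k * a2 ^ k * vm i) := by
    rw [← e1]
    calc _ ≤ _ := hop
      _ = _ := by ring
  have hE := Real.exp_pos (t * (2 * δ * k))
  set E := Real.exp (t * (2 * δ * k))
  have hθk : 0 < θ ^ k := by positivity
  rw [div_pow] at hk
  have hk2 : ρ ^ k < θ ^ k * (v i / C - a1 ^ k * vp i - a2 ^ k * vm i) := by
    have : ρ ^ k / θ ^ k < v i / C - a1 ^ k * vp i - a2 ^ k * vm i := by linarith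
    rw [div_lt_iff₀ hθk] at this
    linarith
  have hk3 : θ ^ k * (v i / C - a1 ^ k * vp i - a2 ^ k * vm i) ≤ Y := by
    rw [e3] at hop2
    have h5 : C * E * (θ ^ k * (v i / C - a1 ^ k * vp i - a2 ^ k * vm i)) ≤ C * E * Y := by
      have : C * E * (θ ^ k * (v i / C - a1 ^ k * vp i - a2 ^ k * vm i))
        = E * θ ^ k * v i - C * (E * θ ^ k * a1 ^ k * vp i) - C * (E * θ ^ k * a2 ^ k * vm i) := by
        field_simp
      rw [this]; linarith
    exact le_of_mul_le_mul_left h5 (by positivity)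
  linarith

lemma halfInd_support {p : ZMod 3 → ℝ} (u : ℝ) (k : ℕ) (s : ℝ) (i : ZMod 3)
    (h : (opA p u ^ k) halfInd s i ≠ 0) : -(k * (1 + |u|)) ≤ s := by
  induction k generalizing s i with
  | zero =>
    simp only [pow_zero] at h
    have : halfInd s i ≠ 0 := h
    unfold halfInd at this
    simp only [ne_eq, ite_eq_right_iff, one_ne_zero, imp_false, not_not] at this
    simpa using this
  | succ k ih =>
    rw [opA_pow_succ, opA_apply] at h
    obtain ⟨j, _, hj⟩ := Finset.exists_ne_zero_of_sum_ne_zero h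
    have := ih _ _ (right_ne_zero_of_mul hj)
    have h1 := (abs_le.1 (repInt_abs (j - i))).2
    have h2 := neg_abs_le u
    push_cast
    linarith

/-- Existence of the bounded excessive function. -/
lemma exists_phi (p : ZMod 3 → ℝ) (hp : ∀ i, 0 < p i) (hsum : p 0 + p 1 + p 2 = 1)
    {t L δ : ℝ} (ht : 0 < t) (hδ : 0 < δ) 
    (hJ : cubJ (p 0 * p 1 * p 2) t + t * δ < L) :
    ∃ (ρ B K : ℝ) (φ : ℝ → ZMod 3 → ℝ), Real.exp (-L) < ρ ∧ (∀ s i, 0 ≤ φ s i) ∧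
      (∀ s i, φ s i ≤ B) ∧
      (∀ s i, ρ * φ s i ≤ opA p (cubD (p 0 * p 1 * p 2) t - δ) φ s i) ∧
      (∀ i, 1 ≤ φ 0 i) ∧ (∀ s i, 0 < φ s i → -K ≤ s) := by
  obtain ⟨ρ, hρ, k, hk0, hk⟩ := cramer_lower p hp hsum ht hδ hJ
  have hρ0 : 0 < ρ := (Real.exp_pos _).trans hρ
  set u := cubD (p 0 * p 1 * p 2) t - δ
  have hpow_nonneg : ∀ m s i, 0 ≤ (opA p u ^ m) halfInd s i := by
    intro m s i
    have := opA_pow_mono hp u (h := 0) (h' := halfInd) halfInd_nonneg m s i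
    simpa using this
  have hpow_le : ∀ m s i, (opA p u ^ m) halfInd s i ≤ 1 := by
    intro m
    induction m with
    | zero => exact halfInd_le
    | succ m ih =>
      intro s i
      rw [opA_pow_succ, opA_apply, sum_zmod3]
      have h0 := hp 0; have h1 := hp 1; have h2 := hp 2
      have a := fun s j => mul_le_mul_of_nonneg_left (ih s j) (hp j).le
      calc _ ≤ p 0 * 1 + p 1 * 1 + p 2 * 1 := add_le_add (add_le_add (a _ _) (a _ _)) (a _ _)
        _ = 1 := by linarith
  have hk1 : ∀ s i, ρ ^ k * halfInd s i ≤ (opA p u ^ k) halfInd s i := by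
    intro s i
    by_cases hs : 0 ≤ s
    · have : halfInd s i = 1 := by simp [halfInd, hs]
      rw [this, mul_one]
      exact (hk i).trans (opA_pow_monoS hp u halfInd_mono k 0 s i hs)
    · have : halfInd s i = 0 := by simp [halfInd, hs]
      rw [this, mul_zero]; exact hpow_nonneg _ _ _
  set φ : ℝ → ZMod 3 → ℝ := ∑ m ∈ Finset.range k, (ρ⁻¹ ^ m) • (opA p u ^ m) halfInd with hφ
  have hφa : ∀ s i, φ s i = ∑ m ∈ Finset.range k, ρ⁻¹ ^ m * (opA p u ^ m) halfInd s i := by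
    intro s i; rw [hφ]; simp [Finset.sum_apply]
  have hinv : 0 < ρ⁻¹ := inv_pos.2 hρ0
  have hterm : ∀ s i m, 0 ≤ ρ⁻¹ ^ m * (opA p u ^ m) halfInd s i :=
    fun s i m => mul_nonneg (by positivity) (hpow_nonneg _ _ _)
  refine ⟨ρ, ∑ m ∈ Finset.range k, ρ⁻¹ ^ m, k * (1 + |u|), φ, hρ, ?_, ?_, ?_, ?_, ?_⟩
  · intro s i
    rw [hφa]
    exact Finset.sum_nonneg fun m _ => hterm s i m
  · intro s i
    rw [hφa]
    refine Finset.sum_le_sum fun m _ => ?_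
    have := mul_le_mul_of_nonneg_left (hpow_le m s i) (show 0 ≤ ρ⁻¹ ^ m by positivity)
    linarith
  · intro s i
    have e : opA p u φ s i
        = ρ * ∑ m ∈ Finset.range k, ρ⁻¹ ^ (m + 1) * (opA p u ^ (m + 1)) halfInd s i := by
      rw [hφ, map_sum]
      simp only [map_smul, ← opA_pow_succ]
      rw [Finset.sum_apply, Finset.sum_apply, Finset.mul_sum]
      refine Finset.sum_congr rfl fun m _ => ?_
      simp only [Pi.smul_apply, smul_eq_mul, pow_succ ρ⁻¹ m]
      field_simp
    rw [e, hφa]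
    apply mul_le_mul_of_nonneg_left _ hρ0.le
    have h1 := Finset.sum_range_succ (fun m => ρ⁻¹ ^ m * (opA p u ^ m) halfInd s i) k
    have h2 := Finset.sum_range_succ' (fun m => ρ⁻¹ ^ m * (opA p u ^ m) halfInd s i) k
    have h3 : halfInd s i ≤ ρ⁻¹ ^ k * (opA p u ^ k) halfInd s i := by
      rw [inv_pow, ← div_eq_inv_mul, le_div_iff₀ (by positivity)]
      linarith [hk1 s i]
    have h4 : ρ⁻¹ ^ 0 * (opA p u ^ 0) halfInd s i = halfInd s i := by
      rw [pow_zero, one_mul]; rfl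
    rw [h4] at h2
    linarith
  · intro i
    rw [hφa]
    have h1 := Finset.single_le_sum (f := fun m => ρ⁻¹ ^ m * (opA p u ^ m) halfInd 0 i)
      (fun m _ => hterm 0 i m) (Finset.mem_range.2 hk0)
    have h4 : ρ⁻¹ ^ 0 * (opA p u ^ 0) halfInd 0 i = 1 := by
      rw [pow_zero, one_mul]
      show halfInd 0 i = 1
      simp [halfInd]
    simp only [h4] at h1
    exact h1
  · intro s i h
    rw [hφa] at h
    obtain ⟨m, hm, hm'⟩ := Finset.exists_ne_zero_of_sum_ne_zero h.ne'
    have := halfInd_support u m s i (right_ne_zero_of_mul hm')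
    have hmk : (m : ℝ) ≤ k := by exact_mod_cast (Finset.mem_range.1 hm).le
    have := abs_nonneg u
    nlinarith

/-! ### Part C: rooted trees given by a parent function -/

/-- A rooted tree presented by levels, parents and finite sets of children. -/
structure RTree (V : Type*) where
  r : V
  lev : V → ℕ
  par : V → V
  ch : V → Finset V
  lev_zero : ∀ v, lev v = 0 ↔ v = r
  lev_par : ∀ v, v ≠ r → lev v = lev (par v) + 1
  mem_ch : ∀ σ c, c ∈ ch σ ↔ c ≠ r ∧ par c = σ

namespace RTree

variable (T : RTree V)

lemma lev_ch {σ c : V} (h : c ∈ T.ch σ) : T.lev c = T.lev σ + 1 := by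
  obtain ⟨h1, h2⟩ := (T.mem_ch σ c).1 h
  rw [T.lev_par c h1, h2]

lemma par_ch {σ c : V} (h : c ∈ T.ch σ) : T.par c = σ := ((T.mem_ch σ c).1 h).2

/-- vertices at a level -/
def level : ℕ → Finset V
  | 0 => {T.r}
  | n + 1 => (level n).biUnion T.ch

lemma mem_level (n : ℕ) (v : V) : v ∈ T.level n ↔ T.lev v = n := by
  induction n generalizing v with
  | zero => simp [level, T.lev_zero]
  | succ n ih =>
    simp only [level, Finset.mem_biUnion]
    constructor
    · rintro ⟨a, ha, hc⟩
      rw [T.lev_ch hc, (ih a).1 ha]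
    · intro h
      have hr : v ≠ T.r := by
        intro h'
        have := (T.lev_zero v).2 h'
        omega
      have h2 := T.lev_par v hr
      exact ⟨T.par v, (ih _).2 (by omega), (T.mem_ch _ _).2 ⟨hr, rfl⟩⟩

/-- ancestor relation (reflexive) -/
def IsAnc (a b : V) : Prop := T.lev a ≤ T.lev b ∧ T.par^[T.lev b - T.lev a] b = a

lemma isAnc_refl (a : V) : T.IsAnc a a := ⟨le_rfl, by simp⟩

lemma isAnc_ch {σ c v : V} (hc : c ∈ T.ch σ) (h : T.IsAnc c v) : T.IsAnc σ v := by
  have h1 := T.lev_ch hc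
  obtain ⟨h2, h3⟩ := h
  refine ⟨by omega, ?_⟩
  have : T.lev v - T.lev σ = (T.lev v - T.lev c) + 1 := by omega
  rw [this, Function.iterate_succ_apply', h3, T.par_ch hc]

lemma isAnc_trans {a b c : V} (h : T.IsAnc a b) (h' : T.IsAnc b c) : T.IsAnc a c := by
  obtain ⟨h1, h2⟩ := h
  obtain ⟨h3, h4⟩ := h'
  refine ⟨by omega, ?_⟩
  have : T.lev c - T.lev a = (T.lev b - T.lev a) + (T.lev c - T.lev b) := by omega
  rw [this, Function.iterate_add_apply, h4, h2]

lemma isAnc_unique {a a' b : V} (h : T.IsAnc a b) (h' : T.IsAnc a' b) (hl : T.lev a = T.lev a') :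
    a = a' := by
  rw [← h.2, ← h'.2, hl]

lemma isAnc_par {a b : V} (h : T.IsAnc a b) (hne : a ≠ b) : b ≠ T.r ∧ T.IsAnc a (T.par b) := by
  have hlt : T.lev a < T.lev b := by
    refine lt_of_le_of_ne h.1 fun he => hne ?_
    have := h.2
    rw [he] at this
    simpa using this.symm
  have hr : b ≠ T.r := by
    intro h'
    have := (T.lev_zero b).2 h'
    omega
  have h2 := T.lev_par b hr
  refine ⟨hr, by omega, ?_⟩
  have := h.2
  have e : T.lev b - T.lev a = (T.lev (T.par b) - T.lev a) + 1 := by omega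
  rw [e, Function.iterate_succ_apply] at this
  exact this

lemma isAnc_cases {σ v : V} (h : T.IsAnc σ v) : v = σ ∨ ∃ c ∈ T.ch σ, T.IsAnc c v := by
  obtain ⟨k, hk⟩ : ∃ k, T.lev v = T.lev σ + k := ⟨T.lev v - T.lev σ, by have := h.1; omega⟩
  induction k generalizing v with
  | zero =>
    left
    have := h.2
    rw [hk] at this
    simpa using this
  | succ k ih =>
    right
    have hne : σ ≠ v := by rintro rfl; omega
    obtain ⟨h1, h2⟩ := T.isAnc_par h hne
    have h3 := T.lev_par v h1
    have hpv : T.IsAnc (T.par v) v := T.isAnc_ch ((T.mem_ch _ _).2 ⟨h1, rfl⟩) (T.isAnc_refl v)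
    rcases ih h2 (by omega) with h4 | ⟨c, hc, h4⟩
    · exact ⟨v, (T.mem_ch _ _).2 ⟨h1, h4⟩, T.isAnc_refl v⟩
    · exact ⟨c, hc, T.isAnc_trans h4 hpv⟩

lemma isAnc_root (v : V) : T.IsAnc T.r v := by
  obtain ⟨k, hk⟩ : ∃ k, T.lev v = k := ⟨_, rfl⟩
  induction k generalizing v with
  | zero => rw [(T.lev_zero v).1 hk]; exact T.isAnc_refl _
  | succ k ih =>
    have hr : v ≠ T.r := by
      intro h'
      have := (T.lev_zero v).2 h'
      omega
    have h3 := T.lev_par v hr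
    exact T.isAnc_trans (ih (T.par v) (by omega))
      (T.isAnc_ch ((T.mem_ch _ _).2 ⟨hr, rfl⟩) (T.isAnc_refl v))

/-- descending rays -/
def IsRay (σ : V) (γ : ℕ → V) : Prop := γ 0 = σ ∧ ∀ n, γ (n + 1) ∈ T.ch (γ n)

lemma ray_lev {γ : ℕ → V} {σ : V} (h : T.IsRay σ γ) (n : ℕ) : T.lev (γ n) = T.lev σ + n := by
  induction n with
  | zero => rw [h.1]; rfl
  | succ n ih => rw [T.lev_ch (h.2 n), ih]; rfl

lemma ray_anc {γ : ℕ → V} {σ : V} (h : T.IsRay σ γ) (n k : ℕ) : T.IsAnc (γ n) (γ (n + k)) := by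
  induction k with
  | zero => exact T.isAnc_refl _
  | succ k ih => exact T.isAnc_trans ih (T.isAnc_ch (h.2 (n + k)) (T.isAnc_refl _))

lemma exists_ray [Infinite V] : ∃ γ, T.IsRay T.r γ := by
  have step : ∀ σ : {σ : V // {v | T.IsAnc σ v}.Infinite},
      ∃ c : {σ : V // {v | T.IsAnc σ v}.Infinite}, c.1 ∈ T.ch σ.1 := by
    rintro ⟨σ, hσ⟩
    by_contra hne
    push Not at hne
    apply hσ
    have : {v | T.IsAnc σ v} ⊆ {σ} ∪ ⋃ c ∈ T.ch σ, {v | T.IsAnc c v} := by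
      intro v hv
      rcases T.isAnc_cases hv with h | ⟨c, hc, h⟩
      · left; exact h
      · right
        exact Set.mem_biUnion hc h
    refine Set.Finite.subset ?_ this
    refine (Set.finite_singleton σ).union ?_
    refine (T.ch σ).finite_toSet.biUnion fun c hc => ?_
    by_contra hinf
    exact hne ⟨c, hinf⟩ hc
  choose f hf using step
  have hroot : {v | T.IsAnc T.r v}.Infinite := by
    have : {v | T.IsAnc T.r v} = Set.univ := by
      ext v; simpa using T.isAnc_root v
    rw [this]; exact Set.infinite_univ
  refine ⟨fun n => (f^[n] ⟨T.r, hroot⟩).1, rfl, fun n => ?_⟩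
  show (f^[n + 1] ⟨T.r, hroot⟩).1 ∈ _
  rw [Function.iterate_succ_apply']
  exact hf _

/-- subtree up to a given depth -/
def sub : ℕ → V → Finset V
  | 0, σ => {σ}
  | d + 1, σ => insert σ ((T.ch σ).biUnion (sub d))

lemma sub_anc {d : ℕ} {σ v : V} (h : v ∈ T.sub d σ) : T.IsAnc σ v := by
  induction d generalizing σ with
  | zero =>
    simp only [sub, Finset.mem_singleton] at h
    rw [h]; exact T.isAnc_refl _
  | succ d ih =>
    simp only [sub, Finset.mem_insert, Finset.mem_biUnion] at h
    rcases h with rfl | ⟨c, hc, h⟩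
    · exact T.isAnc_refl _
    · exact T.isAnc_ch hc (ih h)

lemma self_mem_sub (d : ℕ) (σ : V) : σ ∈ T.sub d σ := by
  cases d <;> simp [sub]

/-- the capped min-cut function -/
def gfun (l : ℝ) : ℕ → V → ℝ
  | 0, _ => 1
  | d + 1, σ => min 1 (∑ c ∈ T.ch σ, l⁻¹ * gfun l d c)

lemma gfun_nonneg {l : ℝ} (hl : 0 < l) (d : ℕ) (σ : V) : 0 ≤ T.gfun l d σ := by
  induction d generalizing σ with
  | zero => simp [gfun]
  | succ d ih =>
    simp only [gfun]
    exact le_min zero_le_one (Finset.sum_nonneg fun c _ => mul_nonneg (inv_pos.2 hl).le (ih c))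

lemma gfun_le_one {l : ℝ} (d : ℕ) (σ : V) : T.gfun l d σ ≤ 1 := by
  cases d with
  | zero => simp [gfun]
  | succ d => simp only [gfun]; exact min_le_left _ _

/-- a cut below `σ` -/
def IsCutBelow (σ : V) (C : Finset V) : Prop :=
  (∀ v ∈ C, T.IsAnc σ v) ∧ (∀ a ∈ C, ∀ b ∈ C, T.IsAnc a b → a = b) ∧
  ∀ γ, T.IsRay σ γ → ∃ n, γ n ∈ C

lemma cut_children {l : ℝ} (d : ℕ) (σ : V)
    (h : ∀ c ∈ T.ch σ, ∃ C, T.IsCutBelow c C ∧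
      ∑ τ ∈ C, l⁻¹ ^ T.lev τ ≤ l⁻¹ ^ T.lev c * T.gfun l d c) :
    ∃ C, T.IsCutBelow σ C ∧ σ ∉ C ∧
      ∑ τ ∈ C, l⁻¹ ^ T.lev τ ≤ l⁻¹ ^ T.lev σ * ∑ c ∈ T.ch σ, l⁻¹ * T.gfun l d c := by
  choose! C hC hC' using h
  refine ⟨(T.ch σ).biUnion C, ⟨?_, ?_, ?_⟩, ?_, ?_⟩
  · intro v hv
    obtain ⟨c, hc, hv⟩ := Finset.mem_biUnion.1 hv
    exact T.isAnc_ch hc ((hC c hc).1 v hv)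
  · intro a ha b hb hab
    obtain ⟨c, hc, ha⟩ := Finset.mem_biUnion.1 ha
    obtain ⟨c', hc', hb⟩ := Finset.mem_biUnion.1 hb
    have h1 := T.isAnc_trans ((hC c hc).1 a ha) hab
    have h2 := (hC c' hc').1 b hb
    have : c = c' := T.isAnc_unique h1 h2 (by rw [T.lev_ch hc, T.lev_ch hc'])
    subst this
    exact (hC c hc).2.1 a ha b hb hab
  · intro γ hγ
    have hc : γ 1 ∈ T.ch σ := by have := hγ.2 0; rwa [hγ.1] at this
    obtain ⟨n, hn⟩ := (hC _ hc).2.2 (fun n => γ (n + 1)) ⟨rfl, fun n => hγ.2 (n + 1)⟩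
    exact ⟨n + 1, Finset.mem_biUnion.2 ⟨_, hc, hn⟩⟩
  · intro hv
    obtain ⟨c, hc, hv⟩ := Finset.mem_biUnion.1 hv
    have := ((hC c hc).1 _ hv).1
    have := T.lev_ch hc
    omega
  · rw [Finset.sum_biUnion]
    · rw [Finset.mul_sum]
      refine Finset.sum_le_sum fun c hc => (hC' c hc).trans_eq ?_
      rw [T.lev_ch hc, pow_succ]; ring
    · intro c hc c' hc' hne
      refine Finset.disjoint_left.2 fun v hv hv' => hne ?_
      exact T.isAnc_unique ((hC c hc).1 v hv) ((hC c' hc').1 v hv')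
        (by rw [T.lev_ch hc, T.lev_ch hc'])

lemma cut_exists {l : ℝ} (d : ℕ) (σ : V) : ∃ C, T.IsCutBelow σ C ∧
      ∑ τ ∈ C, l⁻¹ ^ T.lev τ ≤ l⁻¹ ^ T.lev σ * T.gfun l d σ := by
  have hsingle : T.IsCutBelow σ {σ} := by
    refine ⟨?_, ?_, fun γ hγ => ⟨0, by simp [hγ.1]⟩⟩
    · intro v hv; rw [Finset.mem_singleton.1 hv]; exact T.isAnc_refl _
    · intro a ha b hb _
      rw [Finset.mem_singleton.1 ha, Finset.mem_singleton.1 hb]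
  induction d generalizing σ with
  | zero => exact ⟨{σ}, hsingle, by simp [gfun]⟩
  | succ d ih =>
    simp only [gfun]
    rcases le_total 1 (∑ c ∈ T.ch σ, l⁻¹ * T.gfun l d c) with h | h
    · rw [min_eq_left h]
      exact ⟨{σ}, hsingle, by simp⟩
    · rw [min_eq_right h]
      obtain ⟨C, h1, _, h3⟩ := T.cut_children d σ (fun c _ => ih c (by
        refine ⟨?_, ?_, fun γ hγ => ⟨0, by simp [hγ.1]⟩⟩
        · intro v hv; rw [Finset.mem_singleton.1 hv]; exact T.isAnc_refl _
        · intro a ha b hb _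
          rw [Finset.mem_singleton.1 ha, Finset.mem_singleton.1 hb]))
      exact ⟨C, h1, h3⟩

lemma gfun_root_lower {l ε : ℝ}
    (h : ∀ C, T.IsCutBelow T.r C → T.r ∉ C → ε ≤ ∑ τ ∈ C, l⁻¹ ^ T.lev τ) (d : ℕ) :
    min 1 ε ≤ T.gfun l d T.r := by
  cases d with
  | zero => simp [gfun]
  | succ d =>
    simp only [gfun]
    obtain ⟨C, h1, h2, h3⟩ := T.cut_children (l := l) d T.r (fun c _ => T.cut_exists d c)
    have h4 := h C h1 h2
    have : T.lev T.r = 0 := (T.lev_zero _).2 rfl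
    rw [this, pow_zero, one_mul] at h3
    exact min_le_min le_rfl (h4.trans h3)

end RTree

/-! ### Part D: independence, and measurability on the product space -/

/-- cylinder characterization of the product measure -/
def IsProdCol (p : ZMod 3 → ℝ) (μ : Measure (V → ZMod 3)) : Prop :=
  ∀ (s : Finset V) (κ : V → ZMod 3),
      μ {ω : V → ZMod 3 | ∀ u ∈ s, ω u = κ u} = ∏ u ∈ s, ENNReal.ofReal (p (κ u))

/-- sigma-algebra generated by one coordinate -/
def coordM (v : V) : MeasurableSpace (V → ZMod 3) :=
  MeasurableSpace.comap (fun ω => ω v) ⊤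

/-- sigma-algebra generated by a set of coordinates -/
def cM (A : Set V) : MeasurableSpace (V → ZMod 3) := ⨆ v ∈ A, coordM v

lemma coordM_le (v : V) : coordM v ≤ (MeasurableSpace.pi : MeasurableSpace (V → ZMod 3)) := by
  have h : Measurable (fun ω : V → ZMod 3 => ω v) := measurable_pi_apply v
  exact h.comap_le

lemma cM_le (A : Set V) : cM A ≤ (MeasurableSpace.pi : MeasurableSpace (V → ZMod 3)) :=
  iSup₂_le fun v _ => coordM_le v

lemma cM_mono {A B : Set V} (h : A ⊆ B) : cM A ≤ cM B :=
  iSup₂_le fun v hv => le_iSup₂_of_le v (h hv) le_rfl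

lemma coord_le_cM {A : Set V} {v : V} (hv : v ∈ A) : coordM v ≤ cM A :=
  le_iSup₂_of_le v hv le_rfl

lemma measurable_coord {A : Set V} {v : V} (hv : v ∈ A) :
    Measurable[cM A] (fun ω : V → ZMod 3 => ω v) := by
  intro s _
  exact coord_le_cM hv _ ⟨s, trivial, rfl⟩

lemma measurableSet_coord {A : Set V} {v : V} (hv : v ∈ A) (a : ZMod 3) :
    MeasurableSet[cM A] {ω : V → ZMod 3 | ω v = a} :=
  coord_le_cM hv _ ⟨{a}, trivial, rfl⟩

lemma pi_le_cM : (MeasurableSpace.pi : MeasurableSpace (V → ZMod 3)) ≤ cM Set.univ :=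
  iSup_le fun v => le_trans (le_refl (coordM v)) (coord_le_cM (Set.mem_univ v))

lemma IsProdCol.coord {p : ZMod 3 → ℝ} {μ : Measure (V → ZMod 3)} (h : IsProdCol p μ)
    (v : V) (a : ZMod 3) : μ {ω | ω v = a} = ENNReal.ofReal (p a) := by
  have := h {v} (fun _ => a)
  simpa using this

lemma IsProdCol.iIndep {p : ZMod 3 → ℝ} {μ : Measure (V → ZMod 3)} (h : IsProdCol p μ)
    [IsProbabilityMeasure μ] :
    ProbabilityTheory.iIndep (coordM (V := V)) μ := by
  let π : V → Set (Set (V → ZMod 3)) := fun v =>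
    {s | s = ∅ ∨ ∃ a : ZMod 3, s = {ω | ω v = a}}
  have hgen : ∀ v, coordM v = MeasurableSpace.generateFrom (π v) := by
    intro v
    apply le_antisymm
    · rintro s ⟨B, _, rfl⟩
      have : (fun ω : V → ZMod 3 => ω v) ⁻¹' B = ⋃ a ∈ B, {ω | ω v = a} := by
        ext ω; simp
      rw [this]
      refine MeasurableSet.biUnion (Set.to_countable B) fun a _ => ?_
      exact MeasurableSpace.measurableSet_generateFrom (Or.inr ⟨a, rfl⟩)
    · refine MeasurableSpace.generateFrom_le ?_
      rintro s (rfl | ⟨a, rfl⟩)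
      · exact @MeasurableSet.empty _ (coordM v)
      · exact ⟨{a}, trivial, rfl⟩
  refine ProbabilityTheory.iIndepSets.iIndep coordM_le π ?_ hgen ?_
  · intro v s hs t ht _
    rcases hs with rfl | ⟨a, rfl⟩
    · left; simp
    rcases ht with rfl | ⟨b, rfl⟩
    · left; simp
    by_cases hab : a = b
    · subst hab; right; exact ⟨a, by simp⟩
    · left
      ext ω
      simp only [Set.mem_inter_iff, Set.mem_empty_iff_false, iff_false]
      rintro ⟨h1, h2⟩
      exact hab ((show ω v = a from h1).symm.trans h2)
  · rw [ProbabilityTheory.iIndepSets_iff]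
    intro s f hf
    by_cases hem : ∃ i ∈ s, f i = ∅
    · obtain ⟨i, hi, he⟩ := hem
      rw [Finset.prod_eq_zero hi (by rw [he]; simp)]
      refine measure_mono_null (Set.biInter_subset_of_mem hi) (by rw [he]; simp)
    · have hc : ∀ i, ∃ a : ZMod 3, i ∈ s → f i = {ω | ω i = a} := by
        intro i
        by_cases hi : i ∈ s
        · rcases hf i hi with h0 | ⟨a, ha⟩
          · exact absurd ⟨i, hi, h0⟩ hem
          · exact ⟨a, fun _ => ha⟩
        · exact ⟨0, fun h => absurd h hi⟩
      choose κ hκ using hc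
      have h1 : (⋂ i ∈ s, f i) = {ω | ∀ u ∈ s, ω u = κ u} := by
        ext ω
        simp only [Set.mem_iInter]
        constructor
        · intro hω u hu
          have := hω u hu
          rw [hκ u hu] at this
          exact this
        · intro hω u hu
          rw [hκ u hu]
          exact hω u hu
      rw [h1, h s κ]
      refine Finset.prod_congr rfl fun i hi => ?_
      rw [hκ i hi, h.coord]

lemma IsProdCol.indep {p : ZMod 3 → ℝ} {μ : Measure (V → ZMod 3)} (h : IsProdCol p μ)
    [IsProbabilityMeasure μ] {A B : Set V} (hd : Disjoint A B) :
    ProbabilityTheory.Indep (cM A) (cM B) μ :=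
  ProbabilityTheory.indep_iSup_of_disjoint coordM_le h.iIndep hd

lemma IsProdCol.inter {p : ZMod 3 → ℝ} {μ : Measure (V → ZMod 3)} (h : IsProdCol p μ)
    [IsProbabilityMeasure μ] {A B : Set V} (hd : Disjoint A B) {s t : Set (V → ZMod 3)}
    (hs : MeasurableSet[cM A] s) (ht : MeasurableSet[cM B] t) :
    μ.real (s ∩ t) = μ.real s * μ.real t := by
  have := (ProbabilityTheory.Indep_iff _ _ _).1 (h.indep hd) s t hs ht
  simp [Measure.real, this]

lemma IsProdCol.prod_compl {p : ZMod 3 → ℝ} {μ : Measure (V → ZMod 3)} (h : IsProdCol p μ)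
    [IsProbabilityMeasure μ] {ι : Type*} (F : Finset ι) (D : ι → Set V)
    (E : ι → Set (V → ZMod 3))
    (hD : ∀ i ∈ F, ∀ j ∈ F, i ≠ j → Disjoint (D i) (D j))
    (hE : ∀ i ∈ F, MeasurableSet[cM (D i)] (E i)) :
    μ.real (⋂ i ∈ F, (E i)ᶜ) = ∏ i ∈ F, (1 - μ.real (E i)) := by
  induction F using Finset.induction_on with
  | empty => simp
  | insert a F ha ih =>
    have h1 : (⋂ i ∈ insert a F, (E i)ᶜ) = (E a)ᶜ ∩ ⋂ i ∈ F, (E i)ᶜ := by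
      ext ω; simp
    have hEa := hE a (Finset.mem_insert_self _ _)
    rw [h1, h.inter (A := D a) (B := ⋃ i ∈ F, D i), Finset.prod_insert ha, ih]
    · congr 1
      rw [measureReal_compl (cM_le _ _ hEa)]
      simp
    · exact fun i hi j hj => hD i (Finset.mem_insert_of_mem hi) j (Finset.mem_insert_of_mem hj)
    · exact fun i hi => hE i (Finset.mem_insert_of_mem hi)
    · refine Set.disjoint_iUnion₂_right.2 fun i hi => ?_
      exact hD a (Finset.mem_insert_self _ _) i (Finset.mem_insert_of_mem hi)
        (fun e => ha (e ▸ hi))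
    · exact MeasurableSet.compl hEa
    · refine Finset.measurableSet_biInter F fun i hi => ?_
      refine MeasurableSet.compl ?_
      exact cM_mono (Set.subset_biUnion_of_mem (u := D) hi) _ (hE i (Finset.mem_insert_of_mem hi))

lemma prod_one_sub_mul {ι : Type*} (F : Finset ι) (a : ι → ℝ) (h0 : ∀ i ∈ F, 0 ≤ a i)
    (h1 : ∀ i ∈ F, a i ≤ 1) : (∏ i ∈ F, (1 - a i)) * (1 + ∑ i ∈ F, a i) ≤ 1 := by
  induction F using Finset.induction_on with
  | empty => simp
  | insert b F hb ih =>
    rw [Finset.prod_insert hb, Finset.sum_insert hb]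
    have i1 := ih (fun i hi => h0 i (Finset.mem_insert_of_mem hi))
      (fun i hi => h1 i (Finset.mem_insert_of_mem hi))
    have hb0 := h0 b (Finset.mem_insert_self _ _)
    have hb1 := h1 b (Finset.mem_insert_self _ _)
    have hP : ∏ i ∈ F, (1 - a i) ≤ 1 := by
      refine Finset.prod_le_one ?_ ?_
      · intro i hi; have := h1 i (Finset.mem_insert_of_mem hi); linarith
      · intro i hi; have := h0 i (Finset.mem_insert_of_mem hi); linarith
    set P := ∏ i ∈ F, (1 - a i)
    set Q := ∑ i ∈ F, a i
    have e : (1 - a b) * P * (1 + (a b + Q)) = (1 - a b) * (P * (1 + Q) + P * a b) := by ring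
    rw [e]
    have h2 : P * (1 + Q) + P * a b ≤ 1 + a b := by nlinarith
    nlinarith

lemma IsProdCol.union_lower {p : ZMod 3 → ℝ} {μ : Measure (V → ZMod 3)} (h : IsProdCol p μ)
    [IsProbabilityMeasure μ] {ι : Type*} (F : Finset ι) (D : ι → Set V)
    (E : ι → Set (V → ZMod 3))
    (hD : ∀ i ∈ F, ∀ j ∈ F, i ≠ j → Disjoint (D i) (D j))
    (hE : ∀ i ∈ F, MeasurableSet[cM (D i)] (E i)) {x : ℝ} (hx0 : 0 ≤ x)
    (hx : x ≤ ∑ i ∈ F, μ.real (E i)) :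
    x / (1 + x) ≤ μ.real (⋃ i ∈ F, E i) := by
  have h1 := h.prod_compl F D E hD hE
  have h2 : (⋂ i ∈ F, (E i)ᶜ) = (⋃ i ∈ F, E i)ᶜ := by simp
  have hm : MeasurableSet (⋃ i ∈ F, E i) :=
    Finset.measurableSet_biUnion F fun i hi => cM_le _ _ (hE i hi)
  rw [h2, measureReal_compl hm] at h1
  have h3 := prod_one_sub_mul F (fun i => μ.real (E i)) (fun _ _ => measureReal_nonneg)
    (fun _ _ => measureReal_le_one)
  rw [← h1] at h3
  have h4 : μ.real (Set.univ : Set (V → ZMod 3)) = 1 := by simp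
  rw [h4] at h3
  set m := μ.real (⋃ i ∈ F, E i)
  have hm1 : m ≤ 1 := measureReal_le_one
  rw [div_le_iff₀ (by linarith)]
  nlinarith

/-! ### Part E: percolation lower bound -/

namespace RTree
variable (T : RTree V)

/-- the walk associated to the CCA one-form -/
structure IsWalk (S : (V → ZMod 3) → V → ℤ) : Prop where
  root : ∀ ω, S ω T.r = 0
  step : ∀ ω σ c, c ∈ T.ch σ → S ω c = S ω σ + dXcca ω σ c

/-- events of survival of the percolation -/
def Good (φ : ℝ → ZMod 3 → ℝ) (u : ℝ) : ℕ → V → ℝ → ZMod 3 → Set (V → ZMod 3)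
  | 0, _, s, i => {_ω | 0 < φ s i}
  | d + 1, σ, s, i => ⋃ c ∈ T.ch σ, ⋃ j : ZMod 3,
      {ω | ω c = j} ∩ Good φ u d c (s + (ZMod.repInt (j - i) : ℝ) - u) j

/-- strict descendants -/
def sdesc (σ : V) : Set V := {v | T.IsAnc σ v ∧ v ≠ σ}

/-- descendants -/
def desc (σ : V) : Set V := {v | T.IsAnc σ v}

lemma desc_ch {σ c : V} (h : c ∈ T.ch σ) : T.desc c ⊆ T.sdesc σ := by
  intro v hv
  have hv : T.IsAnc c v := hv
  refine ⟨T.isAnc_ch h hv, ?_⟩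
  rintro rfl
  have := hv.1
  have := T.lev_ch h
  omega

lemma sdesc_sub (σ : V) : T.sdesc σ ⊆ T.desc σ := fun _ h => h.1

lemma desc_disjoint {σ c c' : V} (h : c ∈ T.ch σ) (h' : c' ∈ T.ch σ) (hne : c ≠ c') :
    Disjoint (T.desc c) (T.desc c') := by
  refine Set.disjoint_left.2 fun v hv hv' => hne ?_
  exact T.isAnc_unique hv hv' (by rw [T.lev_ch h, T.lev_ch h'])

lemma measurable_Good (φ : ℝ → ZMod 3 → ℝ) (u : ℝ) (d : ℕ) (σ : V) (s : ℝ) (i : ZMod 3) :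
    MeasurableSet[cM (T.sdesc σ)] (T.Good φ u d σ s i) := by
  induction d generalizing σ s i with
  | zero => exact @MeasurableSet.const _ (cM (T.sdesc σ)) _
  | succ d ih =>
    simp only [Good]
    refine Finset.measurableSet_biUnion _ fun c hc => ?_
    refine MeasurableSet.iUnion fun j => ?_
    refine MeasurableSet.inter ?_ ?_
    · exact measurableSet_coord (T.desc_ch hc (T.isAnc_refl c)) j
    · exact cM_mono ((T.sdesc_sub c).trans (T.desc_ch hc)) _ (ih _ _ _)

lemma sum_coord {p : ZMod 3 → ℝ} (hp : ∀ i, 0 < p i) {μ : Measure (V → ZMod 3)}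
    (h : IsProdCol p μ) [IsProbabilityMeasure μ] (c : V) (E : ZMod 3 → Set (V → ZMod 3))
    (hE : ∀ j, MeasurableSet[cM (T.sdesc c)] (E j)) :
    μ.real (⋃ j : ZMod 3, {ω | ω c = j} ∩ E j) = ∑ j, p j * μ.real (E j) := by
  have hd : Disjoint ({c} : Set V) (T.sdesc c) := by
    refine Set.disjoint_left.2 fun v hv hv' => hv'.2 hv
  rw [measureReal_iUnion_fintype]
  · refine Finset.sum_congr rfl fun j _ => ?_
    rw [h.inter hd (measurableSet_coord (Set.mem_singleton c) j) (hE j)]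
    congr 1
    rw [Measure.real, h.coord, ENNReal.toReal_ofReal (hp j).le]
  · intro i j hij
    refine Set.disjoint_left.2 fun ω h1 h2 => hij ?_
    exact (show ω c = i from h1.1).symm.trans h2.1
  · intro j
    refine MeasurableSet.inter ?_ (cM_le _ _ (hE j))
    exact cM_le _ _ (measurableSet_coord (Set.mem_singleton c) j)

lemma good_lower {p : ZMod 3 → ℝ} (hp : ∀ i, 0 < p i) {μ : Measure (V → ZMod 3)}
    (h : IsProdCol p μ) [IsProbabilityMeasure μ] {φ : ℝ → ZMod 3 → ℝ} {u ρ B l k : ℝ}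
    (hl : 0 < l) (hk : 0 ≤ k) (hρ : 0 ≤ ρ)
    (h0 : ∀ s i, 0 ≤ φ s i) (hB : ∀ s i, φ s i ≤ B)
    (hφ : ∀ s i, ρ * φ s i ≤ opA p u φ s i)
    (hk1 : k * B ≤ 1) (hk2 : 1 + k * (ρ * l) * B ≤ ρ * l)
    (d : ℕ) (σ : V) (s : ℝ) (i : ZMod 3) :
    k * φ s i * T.gfun l d σ ≤ μ.real (T.Good φ u d σ s i) := by
  induction d generalizing σ s i with
  | zero =>
    simp only [gfun, Good, mul_one]
    by_cases hpos : 0 < φ s i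
    · have : μ.real {_ω : V → ZMod 3 | 0 < φ s i} = 1 := by simp [hpos]
      rw [this]
      exact (mul_le_mul_of_nonneg_left (hB s i) hk).trans hk1
    · have : φ s i = 0 := le_antisymm (not_lt.1 hpos) (h0 s i)
      rw [this]; simp
  | succ d ih =>
    simp only [gfun, Good]
    set Y := ∑ c ∈ T.ch σ, l⁻¹ * T.gfun l d c with hY
    have hY0 : 0 ≤ Y := Finset.sum_nonneg fun c _ =>
      mul_nonneg (inv_pos.2 hl).le (T.gfun_nonneg hl d c)
    set y := min 1 Y with hy
    have hy0 : 0 ≤ y := le_min zero_le_one hY0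
    have hy1 : y ≤ 1 := min_le_left _ _
    have hyY : y ≤ Y := min_le_right _ _
    set E : V → Set (V → ZMod 3) := fun c => ⋃ j : ZMod 3,
      {ω | ω c = j} ∩ T.Good φ u d c (s + (ZMod.repInt (j - i) : ℝ) - u) j with hE
    have hEm : ∀ c ∈ T.ch σ, MeasurableSet[cM (T.desc c)] (E c) := by
      intro c hc
      refine MeasurableSet.iUnion fun j => MeasurableSet.inter ?_ ?_
      · exact measurableSet_coord (show c ∈ T.desc c from T.isAnc_refl c) j
      · exact cM_mono (T.sdesc_sub c) _ (T.measurable_Good _ _ _ _ _ _)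
    have hEv : ∀ c, k * ρ * φ s i * T.gfun l d c ≤ μ.real (E c) := by
      intro c
      rw [hE]
      simp only
      rw [T.sum_coord hp h c _ (fun j => T.measurable_Good _ _ _ _ _ _)]
      calc k * ρ * φ s i * T.gfun l d c = (ρ * φ s i) * (k * T.gfun l d c) := by ring
        _ ≤ opA p u φ s i * (k * T.gfun l d c) :=
            mul_le_mul_of_nonneg_right (hφ s i) (mul_nonneg hk (T.gfun_nonneg hl d c))
        _ = ∑ j, p j * (k * φ (s + (ZMod.repInt (j - i) : ℝ) - u) j * T.gfun l d c) := by
            rw [opA_apply, Finset.sum_mul]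
            refine Finset.sum_congr rfl fun j _ => ?_
            ring
        _ ≤ _ := Finset.sum_le_sum fun j _ => mul_le_mul_of_nonneg_left (ih _ _ _) (hp j).le
    have hρl : 0 ≤ ρ * l := mul_nonneg hρ hl.le
    have hx0 : 0 ≤ k * (ρ * l) * φ s i * y := by
      have := h0 s i
      positivity
    have hx : k * (ρ * l) * φ s i * y ≤ ∑ c ∈ T.ch σ, μ.real (E c) := by
      calc k * (ρ * l) * φ s i * y ≤ k * (ρ * l) * φ s i * Y := by
            refine mul_le_mul_of_nonneg_left hyY ?_
            have := h0 s i
            positivity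
        _ = ∑ c ∈ T.ch σ, k * ρ * φ s i * T.gfun l d c := by
            rw [hY, Finset.mul_sum]
            refine Finset.sum_congr rfl fun c _ => ?_
            field_simp
        _ ≤ _ := Finset.sum_le_sum fun c _ => hEv c
    refine le_trans ?_ (h.union_lower (T.ch σ) T.desc E
      (fun c hc c' hc' hne => T.desc_disjoint hc hc' hne) hEm hx0 hx)
    set x := k * (ρ * l) * φ s i * y with hxdef
    have hxB : x ≤ k * (ρ * l) * B := by
      calc x = k * (ρ * l) * (φ s i * y) := by rw [hxdef]; ring
        _ ≤ k * (ρ * l) * B := by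
          refine mul_le_mul_of_nonneg_left ?_ (mul_nonneg hk hρl)
          calc φ s i * y ≤ φ s i * 1 := mul_le_mul_of_nonneg_left hy1 (h0 s i)
            _ ≤ B := by rw [mul_one]; exact hB s i
    rw [le_div_iff₀ (by linarith)]
    calc k * φ s i * y * (1 + x) ≤ k * φ s i * y * (ρ * l) := by
          refine mul_le_mul_of_nonneg_left (by linarith) ?_
          have := h0 s i
          positivity
      _ = x := by rw [hxdef]; ring

lemma good_walk {S : (V → ZMod 3) → V → ℤ} (hS : T.IsWalk S) {φ : ℝ → ZMod 3 → ℝ} {u K : ℝ}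
    (hK : ∀ s i, 0 < φ s i → -K ≤ s) (d : ℕ) (σ : V) (s : ℝ) (ω : V → ZMod 3)
    (hω : ω ∈ T.Good φ u d σ s (ω σ)) :
    ∃ τ, T.lev τ = T.lev σ + d ∧ -K ≤ s + (S ω τ - S ω σ : ℝ) - u * d := by
  induction d generalizing σ s with
  | zero =>
    refine ⟨σ, rfl, ?_⟩
    have : 0 < φ s (ω σ) := hω
    simpa using hK _ _ this
  | succ d ih =>
    simp only [Good, Set.mem_iUnion] at hω
    obtain ⟨c, hc, j, hj, hg⟩ := hω
    have hj : ω c = j := hj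
    subst hj
    obtain ⟨τ, h1, h2⟩ := ih c _ hg
    refine ⟨τ, by rw [h1, T.lev_ch hc]; ring, ?_⟩
    have h3 := hS.step ω σ c hc
    have h4 : (S ω c : ℝ) = S ω σ + (ZMod.repInt (ω c - ω σ) : ℝ) := by
      rw [h3, dXcca]; push_cast; ring
    push_cast
    linarith

lemma exists_uniform {p : ZMod 3 → ℝ} (hp : ∀ i, 0 < p i) (hsum : p 0 + p 1 + p 2 = 1)
    {μ : Measure (V → ZMod 3)} (h : IsProdCol p μ) [IsProbabilityMeasure μ]
    {S : (V → ZMod 3) → V → ℤ} (hS : T.IsWalk S) {l ε t δ : ℝ} (hl : 0 < l) (hε : 0 < ε)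
    (hcut : ∀ C, T.IsCutBelow T.r C → T.r ∉ C → ε ≤ ∑ τ ∈ C, l⁻¹ ^ T.lev τ)
    (ht : 0 < t) (hδ : 0 < δ) (hJ : cubJ (p 0 * p 1 * p 2) t + t * δ < Real.log l) :
    ∃ c > 0, ∃ K : ℝ, ∀ N : ℕ, c ≤ μ.real {ω | ∃ τ, T.lev τ = N ∧
      (cubD (p 0 * p 1 * p 2) t - δ) * N - K ≤ S ω τ} := by
  obtain ⟨ρ, B, K, φ, hρ, h0, hB, hφ, h1, hK⟩ := exists_phi p hp hsum ht hδ hJ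
  set u := cubD (p 0 * p 1 * p 2) t - δ
  have hρl : 1 < ρ * l := by
    rw [Real.exp_neg, Real.exp_log hl] at hρ
    rw [← inv_mul_cancel₀ hl.ne']
    exact mul_lt_mul_of_pos_right hρ hl
  have hρ0 : 0 < ρ := lt_trans (Real.exp_pos _) hρ
  have hB1 : 1 ≤ B := (h1 0).trans (hB 0 0)
  have hB0 : 0 < B := by linarith
  set k := min (1 / B) ((ρ * l - 1) / (ρ * l * B)) with hkdef
  have hden : 0 < ρ * l * B := by positivity
  have hk : 0 < k := lt_min (by positivity) (div_pos (by linarith) hden)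
  have hk1 : k * B ≤ 1 := by
    have : k ≤ 1 / B := min_le_left _ _
    rwa [le_div_iff₀ hB0] at this
  have hk2 : 1 + k * (ρ * l) * B ≤ ρ * l := by
    have : k ≤ (ρ * l - 1) / (ρ * l * B) := min_le_right _ _
    rw [le_div_iff₀ hden] at this
    nlinarith
  refine ⟨k * min 1 ε, by positivity, K, fun N => ?_⟩
  have hr : T.lev T.r = 0 := (T.lev_zero _).2 rfl
  have hsub : (⋃ j : ZMod 3, {ω | ω T.r = j} ∩ T.Good φ u N T.r 0 j) ⊆
      {ω | ∃ τ, T.lev τ = N ∧ u * N - K ≤ S ω τ} := by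
    intro ω hω
    obtain ⟨j, hj, hg⟩ := Set.mem_iUnion.1 hω
    have hj : ω T.r = j := hj
    subst hj
    obtain ⟨τ, h2, h3⟩ := T.good_walk hS hK N T.r 0 ω hg
    refine ⟨τ, by omega, ?_⟩
    rw [hS.root ω] at h3
    push_cast at h3
    linarith
  refine le_trans ?_ (measureReal_mono hsub)
  rw [T.sum_coord hp h T.r _ (fun j => T.measurable_Good _ _ _ _ _ _)]
  have hg : ∀ j, k * min 1 ε ≤ μ.real (T.Good φ u N T.r 0 j) := by
    intro j
    refine le_trans ?_ (T.good_lower hp h hl hk.le hρ0.le h0 hB hφ hk1 hk2 N T.r 0 j)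
    have h2 := T.gfun_root_lower hcut N
    have h3 : 0 ≤ min 1 ε := by positivity
    calc k * min 1 ε = k * 1 * min 1 ε := by ring
      _ ≤ k * φ 0 j * T.gfun l N T.r := by
        refine mul_le_mul (mul_le_mul_of_nonneg_left (h1 j) hk.le) h2 h3 ?_
        exact mul_nonneg hk.le (h0 _ _)
  calc k * min 1 ε = ∑ j, p j * (k * min 1 ε) := by
        rw [← Finset.sum_mul, sum_zmod3, hsum, one_mul]
    _ ≤ _ := Finset.sum_le_sum fun j _ => mul_le_mul_of_nonneg_left (hg j) (hp j).le

end RTree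

/-! ### Part F: cloud speed, zero-one law, almost sure lower bound -/

namespace RTree
variable (T : RTree V)

/-- maximum of the walk at a level -/
def maxS (s : V → ℤ) (n : ℕ) : ℝ := sSup {x : ℝ | ∃ σ : V, T.lev σ = n ∧ (s σ : ℝ) = x}

/-- cloud speed -/
def speed (s : V → ℤ) : ℝ := limsup (fun n : ℕ => T.maxS s n / n) atTop

lemma level_nonempty [Infinite V] (n : ℕ) : ∃ σ, T.lev σ = n := by
  obtain ⟨γ, hγ⟩ := T.exists_ray
  refine ⟨γ n, ?_⟩
  rw [T.ray_lev hγ, (T.lev_zero _).2 rfl, zero_add]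

lemma lev_induction {P : V → Prop} (h0 : P T.r) (h1 : ∀ σ c, c ∈ T.ch σ → P σ → P c) (v : V) :
    P v := by
  obtain ⟨k, hk⟩ : ∃ k, T.lev v = k := ⟨_, rfl⟩
  induction k generalizing v with
  | zero => rw [(T.lev_zero v).1 hk]; exact h0
  | succ k ih =>
    have hr : v ≠ T.r := by
      intro h'
      have := (T.lev_zero v).2 h'
      omega
    have h3 := T.lev_par v hr
    exact h1 (T.par v) v ((T.mem_ch _ _).2 ⟨hr, rfl⟩) (ih _ (by omega))

variable {T} {S : (V → ZMod 3) → V → ℤ}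

lemma IsWalk.abs_le (hS : T.IsWalk S) (ω : V → ZMod 3) (σ : V) :
    |(S ω σ : ℝ)| ≤ T.lev σ := by
  refine T.lev_induction (P := fun σ => |(S ω σ : ℝ)| ≤ T.lev σ) ?_ ?_ σ
  · rw [hS.root]; simp
  · intro σ c hc ih
    rw [hS.step ω σ c hc, T.lev_ch hc, dXcca]
    push_cast
    exact (abs_add_le _ _).trans (add_le_add ih (repInt_abs _))

lemma IsWalk.bdd (hS : T.IsWalk S) (ω : V → ZMod 3) (n : ℕ) :
    BddAbove {x : ℝ | ∃ σ : V, T.lev σ = n ∧ (S ω σ : ℝ) = x} := by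
  refine ⟨n, ?_⟩
  rintro x ⟨σ, rfl, rfl⟩
  exact (le_abs_self _).trans (hS.abs_le ω σ)

lemma IsWalk.le_maxS (hS : T.IsWalk S) (ω : V → ZMod 3) (σ : V) :
    (S ω σ : ℝ) ≤ T.maxS (S ω) (T.lev σ) :=
  le_csSup (hS.bdd ω _) ⟨σ, rfl, rfl⟩

lemma maxS_le [Infinite V] {s : V → ℤ} {n : ℕ} {a : ℝ} (h : ∀ σ, T.lev σ = n → (s σ : ℝ) ≤ a) :
    T.maxS s n ≤ a := by
  obtain ⟨σ, hσ⟩ := T.level_nonempty n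
  refine csSup_le ⟨_, σ, hσ, rfl⟩ ?_
  rintro x ⟨τ, h1, rfl⟩
  exact h τ h1

lemma IsWalk.maxS_div_le [Infinite V] (hS : T.IsWalk S) (ω : V → ZMod 3) (n : ℕ) :
    T.maxS (S ω) n / n ≤ 1 := by
  refine div_le_one_of_le₀ ?_ (Nat.cast_nonneg n)
  refine maxS_le fun σ hσ => ?_
  rw [← hσ]
  exact (le_abs_self _).trans (hS.abs_le ω σ)

lemma IsWalk.le_maxS_div [Infinite V] (hS : T.IsWalk S) (ω : V → ZMod 3) (n : ℕ) :
    -1 ≤ T.maxS (S ω) n / n := by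
  obtain ⟨σ, hσ⟩ := T.level_nonempty n
  have h1 := hS.le_maxS ω σ
  have h2 := neg_le_of_abs_le (hS.abs_le ω σ)
  rw [hσ] at h1 h2
  rcases Nat.eq_zero_or_pos n with rfl | hn
  · simp
  · rw [le_div_iff₀ (by exact_mod_cast hn)]
    linarith

lemma IsWalk.speed_le [Infinite V] (hS : T.IsWalk S) (ω : V → ZMod 3) {a : ℝ}
    (h : ∀ᶠ n in atTop, T.maxS (S ω) n / (n : ℕ) ≤ a) : T.speed (S ω) ≤ a := by
  refine limsup_le_of_le ?_ h
  exact isCoboundedUnder_le_of_le atTop (x := -1) (fun n => hS.le_maxS_div ω n)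

lemma IsWalk.le_speed [Infinite V] (hS : T.IsWalk S) (ω : V → ZMod 3) {a : ℝ}
    (h : ∃ᶠ n in atTop, a ≤ T.maxS (S ω) n / (n : ℕ)) : a ≤ T.speed (S ω) := by
  refine le_limsup_of_frequently_le h ?_
  exact isBoundedUnder_of ⟨1, fun n => hS.maxS_div_le ω n⟩

lemma IsWalk.speed_le_one [Infinite V] (hS : T.IsWalk S) (ω : V → ZMod 3) :
    T.speed (S ω) ≤ 1 :=
  hS.speed_le ω (Eventually.of_forall fun n => hS.maxS_div_le ω n)

lemma IsWalk.measurable (hS : T.IsWalk S) (σ : V) :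
    Measurable[cM {v | T.lev v ≤ T.lev σ}] (fun ω => S ω σ) := by
  refine T.lev_induction
    (P := fun σ => Measurable[cM {v | T.lev v ≤ T.lev σ}] (fun ω => S ω σ)) ?_ ?_ σ
  · simp only [hS.root]; exact @measurable_const _ _ _ (cM {v | T.lev v ≤ T.lev T.r}) _
  · intro σ c hc ih
    have hl := T.lev_ch hc
    have e : (fun ω => S ω c) = fun ω => S ω σ + ZMod.repInt (ω c - ω σ) := by
      funext ω; exact hS.step ω σ c hc
    rw [e]
    have h1 : Measurable[cM {v | T.lev v ≤ T.lev c}] (fun ω => S ω σ) :=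
      ih.mono (cM_mono fun v (hv : T.lev v ≤ _) => show T.lev v ≤ _ by omega) le_rfl
    have h2 : Measurable[cM {v | T.lev v ≤ T.lev c}] (fun ω : V → ZMod 3 => ω c) :=
      measurable_coord (A := {v | T.lev v ≤ T.lev c}) (show T.lev c ≤ T.lev c from le_rfl)
    have h3 : Measurable[cM {v | T.lev v ≤ T.lev c}] (fun ω : V → ZMod 3 => ω σ) :=
      measurable_coord (A := {v | T.lev v ≤ T.lev c}) (show T.lev σ ≤ T.lev c by omega)
    have h4 : Measurable (fun x : ZMod 3 × ZMod 3 => ZMod.repInt (x.1 - x.2)) :=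
      measurable_of_countable _
    exact h1.add (h4.comp (h2.prodMk h3))

lemma IsWalk.measurable' (hS : T.IsWalk S) (σ : V) : Measurable (fun ω => S ω σ) :=
  (hS.measurable σ).mono (cM_le _) le_rfl

lemma IsWalk.diff (hS : T.IsWalk S) {N : ℕ} {ω ω' : V → ZMod 3}
    (h : ∀ v, N < T.lev v → ω v = ω' v) (σ : V) : |(S ω σ - S ω' σ : ℝ)| ≤ 2 * (N + 1) := by
  have key : |(S ω σ - S ω' σ : ℝ)| ≤ 2 * ((min (T.lev σ) (N + 1) : ℕ) : ℝ) := by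
    refine T.lev_induction
      (P := fun σ => |(S ω σ - S ω' σ : ℝ)| ≤ 2 * ((min (T.lev σ) (N + 1) : ℕ) : ℝ)) ?_ ?_ σ
    · rw [hS.root, hS.root]; simp; positivity
    · intro σ c hc ih
      have hl := T.lev_ch hc
      rw [hS.step ω σ c hc, hS.step ω' σ c hc]
      by_cases hN : T.lev σ ≤ N
      · have e1 : min (T.lev σ) (N + 1) = T.lev σ := by omega
        have e2 : min (T.lev c) (N + 1) = T.lev σ + 1 := by omega
        rw [e1] at ih
        rw [e2]
        have h1 := repInt_abs (ω c - ω σ)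
        have h2 := repInt_abs (ω' c - ω' σ)
        rw [_root_.abs_le] at *
        simp only [dXcca]
        push_cast
        constructor <;> linarith [ih.1, ih.2, h1.1, h1.2, h2.1, h2.2]
      · have e1 : min (T.lev σ) (N + 1) = N + 1 := by omega
        have e2 : min (T.lev c) (N + 1) = N + 1 := by omega
        rw [e1] at ih
        rw [e2]
        have h1 := h σ (by omega)
        have h2 := h c (by omega)
        have : dXcca ω σ c = dXcca ω' σ c := by simp only [dXcca, h1, h2]
        rw [this]
        push_cast at ih ⊢
        convert ih using 2
        ring
  refine key.trans ?_
  have : ((min (T.lev σ) (N + 1) : ℕ) : ℝ) ≤ ((N + 1 : ℕ) : ℝ) :=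
    Nat.cast_le.2 (min_le_right _ _)
  push_cast at this ⊢
  linarith

variable (T) in
/-- frequently exceeding a linear rate -/
def Freq (S : (V → ZMod 3) → V → ℤ) (a : ℝ) : Set (V → ZMod 3) :=
  ⋂ N : ℕ, ⋃ n ∈ Set.Ici N, ⋃ σ ∈ T.level n, {ω | a * n ≤ S ω σ}

lemma mem_Freq {a : ℝ} {ω : V → ZMod 3} :
    ω ∈ T.Freq S a ↔ ∀ N : ℕ, ∃ n ≥ N, ∃ σ, T.lev σ = n ∧ a * n ≤ S ω σ := by
  simp only [Freq, Set.mem_iInter, Set.mem_iUnion]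
  constructor
  · intro h N
    obtain ⟨n, hn, σ, h1, h2⟩ := h N
    exact ⟨n, hn, σ, (T.mem_level _ _).1 h1, h2⟩
  · intro h N
    obtain ⟨n, hn, σ, h1, h2⟩ := h N
    exact ⟨n, hn, σ, (T.mem_level _ _).2 h1, h2⟩

lemma IsWalk.measurable_Freq (hS : T.IsWalk S) (a : ℝ) : MeasurableSet (T.Freq S a) := by
  refine MeasurableSet.iInter fun N => MeasurableSet.biUnion (Set.to_countable _) fun n _ => ?_
  refine Finset.measurableSet_biUnion _ fun σ _ => ?_
  have h : Measurable (fun ω => (S ω σ : ℝ)) := measurable_from_top.comp (hS.measurable' σ)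
  exact measurableSet_le measurable_const h

variable (T) in
/-- tail version of the event that the speed is at least `u` -/
def TailE (S : (V → ZMod 3) → V → ℤ) (u : ℝ) : Set (V → ZMod 3) :=
  ⋂ k : ℕ, T.Freq S (u - 1 / ((k : ℝ) + 1))

lemma IsWalk.measurable_TailE (hS : T.IsWalk S) (u : ℝ) : MeasurableSet (T.TailE S u) :=
  MeasurableSet.iInter fun _ => hS.measurable_Freq _

lemma Freq_of_const {u K : ℝ} {ω : V → ZMod 3}
    (h : ∀ N : ℕ, ∃ n ≥ N, ∃ σ, T.lev σ = n ∧ u * n - K ≤ S ω σ) {a : ℝ} (ha : a < u) :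
    ω ∈ T.Freq S a := by
  rw [mem_Freq]
  intro N
  obtain ⟨M, hM⟩ := exists_nat_ge (K / (u - a))
  obtain ⟨n, hn, σ, h1, h2⟩ := h (max N M)
  refine ⟨n, (le_max_left _ _).trans hn, σ, h1, ?_⟩
  have h3 : (M : ℝ) ≤ n := by exact_mod_cast (le_max_right N M).trans hn
  have h4 : K / (u - a) ≤ n := hM.trans h3
  rw [div_le_iff₀ (by linarith)] at h4
  nlinarith

lemma TailE_of_const {u K : ℝ} {ω : V → ZMod 3}
    (h : ∀ N : ℕ, ∃ n ≥ N, ∃ σ, T.lev σ = n ∧ u * n - K ≤ S ω σ) :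
    ω ∈ T.TailE S u := by
  refine Set.mem_iInter.2 fun k => Freq_of_const h ?_
  have : (0 : ℝ) < 1 / ((k : ℝ) + 1) := by positivity
  linarith

lemma IsWalk.TailE_invariant (hS : T.IsWalk S) {u : ℝ} {N : ℕ} {ω ω' : V → ZMod 3}
    (h : ∀ v, N < T.lev v → ω v = ω' v) (hω : ω ∈ T.TailE S u) : ω' ∈ T.TailE S u := by
  refine Set.mem_iInter.2 fun k => ?_
  have h1 : ω ∈ T.Freq S (u - 1 / (((k + 1 : ℕ) : ℝ) + 1)) := Set.mem_iInter.1 hω (k + 1)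
  rw [mem_Freq] at h1
  refine Freq_of_const (u := u - 1 / (((k + 1 : ℕ) : ℝ) + 1)) (K := 2 * (N + 1)) ?_ ?_
  · intro M
    obtain ⟨n, hn, σ, h2, h3⟩ := h1 M
    refine ⟨n, hn, σ, h2, ?_⟩
    have := (_root_.abs_le.1 (hS.diff h σ)).2
    linarith
  · push_cast
    have : 1 / ((k : ℝ) + 1 + 1) < 1 / ((k : ℝ) + 1) := by
      apply one_div_lt_one_div_of_lt <;> [positivity; linarith]
    linarith

lemma IsWalk.speed_of_TailE [Infinite V] (hS : T.IsWalk S) {u : ℝ} {ω : V → ZMod 3}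
    (hω : ω ∈ T.TailE S u) : u ≤ T.speed (S ω) := by
  refine le_of_forall_lt fun c hc => ?_
  obtain ⟨k, hk⟩ := exists_nat_one_div_lt (sub_pos.2 hc)
  refine lt_of_lt_of_le (b := u - 1 / ((k : ℝ) + 1)) (by linarith) ?_
  refine hS.le_speed ω ?_
  rw [frequently_atTop]
  intro N
  obtain ⟨n, hn, σ, h1, h2⟩ := mem_Freq.1 (Set.mem_iInter.1 hω k) (N + 1)
  refine ⟨n, by omega, ?_⟩
  rw [le_div_iff₀ (by exact_mod_cast (by omega : 0 < n))]
  refine h2.trans ?_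
  rw [← h1]
  exact hS.le_maxS ω σ

lemma IsWalk.TailE_cM (hS : T.IsWalk S) (u : ℝ) (N : ℕ) :
    MeasurableSet[cM {v | N < T.lev v}] (T.TailE S u) := by
  let g : (V → ZMod 3) → (V → ZMod 3) := fun ω v => if N < T.lev v then ω v else 0
  have hg : Measurable[cM {v | N < T.lev v}] g := by
    refine @measurable_pi_lambda _ _ _ (cM {v | N < T.lev v}) _ _ fun v => ?_
    by_cases hv : N < T.lev v
    · simp only [g, hv, if_true]
      exact measurable_coord (A := {v | N < T.lev v}) hv
    · simp only [g, hv, if_false]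
      exact @measurable_const _ _ _ (cM {v | N < T.lev v}) _
  have he : T.TailE S u = g ⁻¹' (T.TailE S u) := by
    ext ω
    have h1 : ∀ v, N < T.lev v → ω v = g ω v := fun v hv => by simp [g, hv]
    exact ⟨fun h => hS.TailE_invariant h1 h,
      fun h => hS.TailE_invariant (fun v hv => (h1 v hv).symm) h⟩
  rw [he]
  exact hg (hS.measurable_TailE u)

lemma IsWalk.TailE_zero_one (hS : T.IsWalk S) {p : ZMod 3 → ℝ}
    {μ : Measure (V → ZMod 3)} (h : IsProdCol p μ) [IsProbabilityMeasure μ] (u : ℝ) :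
    μ (T.TailE S u) = 0 ∨ μ (T.TailE S u) = 1 := by
  have hm := hS.measurable_TailE u
  let m : ℕ → MeasurableSpace (V → ZMod 3) := fun N => cM {v | T.lev v ≤ N}
  have hind : ProbabilityTheory.Indep (⨆ N, m N)
      (MeasurableSpace.generateFrom {T.TailE S u}) μ := by
    refine ProbabilityTheory.indep_iSup_of_monotone ?_ (fun N => cM_le _) ?_ ?_
    · intro N
      have hd : Disjoint {v | T.lev v ≤ N} {v | N < T.lev v} := by
        refine Set.disjoint_left.2 fun v (hv : T.lev v ≤ N) (hv' : N < T.lev v) => by omega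
      refine ProbabilityTheory.indep_of_indep_of_le_right (h.indep hd) ?_
      refine MeasurableSpace.generateFrom_le ?_
      rintro s rfl
      exact hS.TailE_cM u N
    · refine MeasurableSpace.generateFrom_le ?_
      rintro s rfl
      exact hm
    · intro N M hNM
      exact cM_mono fun v (hv : T.lev v ≤ N) => show T.lev v ≤ M from hv.trans hNM
  have hle : (MeasurableSpace.pi : MeasurableSpace (V → ZMod 3)) ≤ ⨆ N, m N := by
    refine pi_le_cM.trans (iSup₂_le fun v _ => ?_)
    exact le_iSup_of_le (T.lev v) (coord_le_cM (A := {w | T.lev w ≤ T.lev v})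
      (show T.lev v ≤ T.lev v from le_rfl))
  apply ProbabilityTheory.measure_eq_zero_or_one_of_indepSet_self
  refine (ProbabilityTheory.IndepSet_iff_Indep _ _ _).2 ?_
  refine ProbabilityTheory.indep_of_indep_of_le_left hind ?_
  refine MeasurableSpace.generateFrom_le ?_
  rintro s rfl
  exact hle _ hm

lemma IsWalk.ae_lower [Infinite V] (hS : T.IsWalk S) {p : ZMod 3 → ℝ} (hp : ∀ i, 0 < p i)
    (hsum : p 0 + p 1 + p 2 = 1)
    {μ : Measure (V → ZMod 3)} (h : IsProdCol p μ) [IsProbabilityMeasure μ]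
    {l ε t δ : ℝ} (hl : 0 < l) (hε : 0 < ε)
    (hcut : ∀ C, T.IsCutBelow T.r C → T.r ∉ C → ε ≤ ∑ τ ∈ C, l⁻¹ ^ T.lev τ)
    (ht : 0 < t) (hδ : 0 < δ) (hJ : cubJ (p 0 * p 1 * p 2) t + t * δ < Real.log l) :
    ∀ᵐ ω ∂μ, cubD (p 0 * p 1 * p 2) t - δ ≤ T.speed (S ω) := by
  obtain ⟨c, hc, K, hN⟩ := T.exists_uniform hp hsum h hS hl hε hcut ht hδ hJ
  set u := cubD (p 0 * p 1 * p 2) t - δ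
  let E : ℕ → Set (V → ZMod 3) := fun N => ⋃ n ∈ Set.Ici N, ⋃ σ ∈ T.level n,
    {ω | u * n - K ≤ S ω σ}
  have hEm : ∀ N, MeasurableSet (E N) := by
    intro N
    refine MeasurableSet.biUnion (Set.to_countable _) fun n _ => ?_
    refine Finset.measurableSet_biUnion _ fun σ _ => ?_
    have h : Measurable (fun ω => (S ω σ : ℝ)) := measurable_from_top.comp (hS.measurable' σ)
    exact measurableSet_le measurable_const h
  have hanti : Antitone E := by
    intro N M hNM
    exact Set.biUnion_subset_biUnion_left (Set.Ici_subset_Ici.2 hNM)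
  have hlim := tendsto_measure_iInter_atTop (μ := μ) (fun N => (hEm N).nullMeasurableSet) hanti
    ⟨0, measure_ne_top _ _⟩
  have hge : ENNReal.ofReal c ≤ μ (⋂ N, E N) := by
    refine ge_of_tendsto' hlim fun N => ?_
    refine le_trans (ENNReal.ofReal_le_ofReal (hN N)) ?_
    rw [Measure.real, ENNReal.ofReal_toReal (measure_ne_top _ _)]
    refine measure_mono ?_
    rintro ω ⟨τ, h1, h2⟩
    simp only [E, Set.mem_iUnion]
    exact ⟨N, le_refl N, τ, (T.mem_level _ _).2 h1, h2⟩
  have hsub : (⋂ N, E N) ⊆ T.TailE S u := by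
    intro ω hω
    refine TailE_of_const (K := K) fun N => ?_
    have := Set.mem_iInter.1 hω N
    simp only [E, Set.mem_iUnion] at this
    obtain ⟨n, hn, σ, h1, h2⟩ := this
    exact ⟨n, hn, σ, (T.mem_level _ _).1 h1, h2⟩
  have hpos : 0 < μ (T.TailE S u) :=
    lt_of_lt_of_le (ENNReal.ofReal_pos.2 hc) (hge.trans (measure_mono hsub))
  have hone : μ (T.TailE S u) = 1 := (hS.TailE_zero_one h u).resolve_left hpos.ne'
  have hae : ∀ᵐ ω ∂μ, ω ∈ T.TailE S u := (prob_compl_eq_zero_iff (hS.measurable_TailE u)).2 hone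
  filter_upwards [hae] with ω hω
  exact hS.speed_of_TailE hω

end RTree

/-! ### Part G: almost sure upper bound -/

namespace RTree
variable {T : RTree V} {S : (V → ZMod 3) → V → ℤ}

lemma IsWalk.measurable_weight (hS : T.IsWalk S) (t : ℝ) (v : ZMod 3 → ℝ) (σ : V) :
    Measurable (fun ω => ENNReal.ofReal (Real.exp (t * S ω σ) * v (ω σ))) := by
  have h1 : Measurable (fun ω => S ω σ) := hS.measurable' σ
  have h2 : Measurable (fun ω : V → ZMod 3 => ω σ) := measurable_pi_apply σ
  have h3 : Measurable (fun z : ℤ × ZMod 3 => ENNReal.ofReal (Real.exp (t * z.1) * v z.2)) :=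
    measurable_of_countable _
  exact h3.comp (h1.prodMk h2)

set_option maxHeartbeats 1000000 in
lemma IsWalk.moment_step (hS : T.IsWalk S) {p : ZMod 3 → ℝ} (hp : ∀ i, 0 < p i)
    {μ : Measure (V → ZMod 3)} (h : IsProdCol p μ) [IsProbabilityMeasure μ]
    {t x : ℝ} {v : ZMod 3 → ℝ} (hx : 0 ≤ x) (hv : ∀ i, 0 < v i)
    (heig : ∀ i, ∑ j, p j * (Real.exp (t * (ZMod.repInt (j - i) : ℝ)) * v j) = x * v i)
    {σ c : V} (hc : c ∈ T.ch σ) :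
    ∫⁻ ω, ENNReal.ofReal (Real.exp (t * S ω c) * v (ω c)) ∂μ =
      ENNReal.ofReal x * ∫⁻ ω, ENNReal.ofReal (Real.exp (t * S ω σ) * v (ω σ)) ∂μ := by
  have hl := T.lev_ch hc
  let f : ZMod 3 → (V → ZMod 3) → ENNReal := fun j ω =>
    ENNReal.ofReal (Real.exp (t * S ω σ) * (Real.exp (t * (ZMod.repInt (j - ω σ) : ℝ)) * v j))
  have hf : ∀ j, Measurable[cM {w | T.lev w ≤ T.lev σ}] (f j) := by
    intro j
    have h1 : Measurable[cM {w | T.lev w ≤ T.lev σ}] (fun ω => S ω σ) := hS.measurable σ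
    have h2 : Measurable[cM {w | T.lev w ≤ T.lev σ}] (fun ω : V → ZMod 3 => ω σ) :=
      measurable_coord (A := {w | T.lev w ≤ T.lev σ}) (show T.lev σ ≤ T.lev σ from le_rfl)
    have h3 : Measurable (fun z : ℤ × ZMod 3 => ENNReal.ofReal (Real.exp (t * z.1) *
        (Real.exp (t * (ZMod.repInt (j - z.2) : ℝ)) * v j))) := measurable_of_countable _
    exact h3.comp (h1.prodMk h2)
  have e1 : ∀ ω, ENNReal.ofReal (Real.exp (t * S ω c) * v (ω c)) =
      ∑ j, f j ω * Set.indicator {ω : V → ZMod 3 | ω c = j} (fun _ => (1 : ENNReal)) ω := by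
    intro ω
    rw [Finset.sum_eq_single (ω c)]
    · have : ω ∈ {ω' : V → ZMod 3 | ω' c = ω c} := rfl
      rw [Set.indicator_of_mem this, mul_one]
      simp only [f]
      rw [hS.step ω σ c hc, dXcca]
      push_cast
      rw [mul_add, Real.exp_add]
      congr 1
      ring
    · intro j _ hj
      have : ω ∉ {ω' : V → ZMod 3 | ω' c = j} := fun h' => hj (show ω c = j from h').symm
      rw [Set.indicator_of_notMem this, mul_zero]
    · simp
  have hd : Disjoint {w | T.lev w ≤ T.lev σ} {c} := by
    refine Set.disjoint_left.2 fun w (hw : T.lev w ≤ T.lev σ) (hw' : w = c) => ?_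
    subst hw'
    omega
  have hms : ∀ j, MeasurableSet {ω : V → ZMod 3 | ω c = j} := fun j =>
    cM_le _ _ (measurableSet_coord (Set.mem_singleton c) j)
  have e2 : ∀ j, ∫⁻ ω, f j ω * Set.indicator {ω : V → ZMod 3 | ω c = j}
      (fun _ => (1 : ENNReal)) ω ∂μ = ENNReal.ofReal (p j) * ∫⁻ ω, f j ω ∂μ := by
    intro j
    rw [ProbabilityTheory.lintegral_mul_indicator_eq_lintegral_mul_lintegral_indicator
      (cM_le _) 1 (hms j) ?_ (hf j)]
    · rw [lintegral_indicator (hms j), mul_comm]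
      simp [h.coord]
    · rw [ProbabilityTheory.IndepSets_iff]
      rintro s _ hs rfl
      exact (ProbabilityTheory.Indep_iff _ _ _).1 (h.indep hd) _ _ hs
        (measurableSet_coord (Set.mem_singleton c) j)
  simp_rw [e1]
  rw [lintegral_finsetSum']
  · simp_rw [e2]
    have hf' : ∀ j, Measurable (f j) := fun j => (hf j).mono (cM_le _) le_rfl
    simp_rw [← lintegral_const_mul _ (hf' _)]
    rw [← lintegral_finsetSum _ (fun j _ => (hf' j).const_mul _), ← lintegral_const_mul]
    · refine lintegral_congr fun ω => ?_
      have h0 : ∀ j, 0 ≤ Real.exp (t * S ω σ) *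
          (Real.exp (t * (ZMod.repInt (j - ω σ) : ℝ)) * v j) := fun j => by
        have := hv j
        positivity
      simp only [f]
      simp_rw [← ENNReal.ofReal_mul (hp _).le]
      rw [← ENNReal.ofReal_sum_of_nonneg (fun j _ => mul_nonneg (hp j).le (h0 j)),
        ← ENNReal.ofReal_mul hx]
      congr 1
      rw [mul_left_comm, ← heig (ω σ), Finset.mul_sum]
      refine Finset.sum_congr rfl fun j _ => ?_
      ring
    · exact hS.measurable_weight t v σ
  · intro j _
    have hf' : Measurable (f j) := (hf j).mono (cM_le _) le_rfl
    exact (hf'.mul (measurable_const.indicator (hms j))).aemeasurable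

lemma IsWalk.moment (hS : T.IsWalk S) {p : ZMod 3 → ℝ} (hp : ∀ i, 0 < p i)
    {μ : Measure (V → ZMod 3)} (h : IsProdCol p μ) [IsProbabilityMeasure μ]
    {t x B : ℝ} {v : ZMod 3 → ℝ} (hx : 0 ≤ x) (hv : ∀ i, 0 < v i) (hB : ∀ i, v i ≤ B)
    (heig : ∀ i, ∑ j, p j * (Real.exp (t * (ZMod.repInt (j - i) : ℝ)) * v j) = x * v i)
    (σ : V) :
    ∫⁻ ω, ENNReal.ofReal (Real.exp (t * S ω σ) * v (ω σ)) ∂μ ≤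
      ENNReal.ofReal (x ^ T.lev σ * B) := by
  refine T.lev_induction (P := fun σ => ∫⁻ ω, ENNReal.ofReal (Real.exp (t * S ω σ) * v (ω σ)) ∂μ ≤
      ENNReal.ofReal (x ^ T.lev σ * B)) ?_ ?_ σ
  · rw [(T.lev_zero _).2 rfl]
    calc ∫⁻ ω, ENNReal.ofReal (Real.exp (t * S ω T.r) * v (ω T.r)) ∂μ
        ≤ ∫⁻ _ω, ENNReal.ofReal B ∂μ := by
          refine lintegral_mono fun ω => ENNReal.ofReal_le_ofReal ?_
          rw [hS.root]
          simpa using hB _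
      _ = _ := by simp
  · intro σ c hc ih
    rw [hS.moment_step hp h hx hv heig hc, T.lev_ch hc, pow_succ', mul_assoc,
      ENNReal.ofReal_mul hx]
    gcongr

lemma IsWalk.markov (hS : T.IsWalk S) {p : ZMod 3 → ℝ} (hp : ∀ i, 0 < p i)
    (hsum : p 0 + p 1 + p 2 = 1)
    {μ : Measure (V → ZMod 3)} (h : IsProdCol p μ) [IsProbabilityMeasure μ] {t : ℝ} (ht : 0 < t) :
    ∃ C > 0, ∀ (σ : V) (a : ℝ), μ.real {ω | a * T.lev σ < S ω σ} ≤
      C * Real.exp (T.lev σ * (LambdaCCA (p 0 * p 1 * p 2) t - t * a)) := by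
  have hq : 0 < p 0 * p 1 * p 2 := mul_pos (mul_pos (hp 0) (hp 1)) (hp 2)
  obtain ⟨v, hv, heig⟩ := exists_eigenvector p hp hsum t
  have hx1 := (cubicRoot_spec hq t).1
  set x := cubicRoot (p 0 * p 1 * p 2) t with hxdef
  have hx0 : 0 < x := by linarith
  have hΛ : x = Real.exp (LambdaCCA (p 0 * p 1 * p 2) t) := by
    rw [LambdaCCA, Real.exp_log]; exact hx0
  set B := v 0 + v 1 + v 2 with hBdef
  have hB : ∀ i, v i ≤ B := by
    intro i
    have h0 := hv 0
    have h1 := hv 1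
    have h2 := hv 2
    rcases zmod3_cases i with rfl | rfl | rfl <;> linarith
  obtain ⟨b, hb0, hb⟩ : ∃ b > 0, ∀ i, b ≤ v i := by
    refine ⟨min (v 0) (min (v 1) (v 2)), lt_min (hv 0) (lt_min (hv 1) (hv 2)), ?_⟩
    intro i
    rcases zmod3_cases i with rfl | rfl | rfl
    · exact min_le_left _ _
    · exact (min_le_right _ _).trans (min_le_left _ _)
    · exact (min_le_right _ _).trans (min_le_right _ _)
  have hB0 : 0 < B := (hv 0).trans_le (hB 0)
  refine ⟨B / b, by positivity, fun σ a => ?_⟩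
  have hm := hS.moment hp h hx0.le hv hB heig σ
  set n := T.lev σ
  have h1 : ENNReal.ofReal (Real.exp (t * (a * n)) * b) * μ {ω | a * n < S ω σ} ≤
      ENNReal.ofReal (x ^ n * B) := by
    refine le_trans ?_ hm
    refine le_trans ?_ (mul_meas_ge_le_lintegral₀ ?_ (ENNReal.ofReal (Real.exp (t * (a * n)) * b)))
    · gcongr
      intro hω
      apply ENNReal.ofReal_le_ofReal
      refine mul_le_mul ?_ (hb _) hb0.le (Real.exp_pos _).le
      exact Real.exp_le_exp.2 (mul_le_mul_of_nonneg_left (le_of_lt hω) ht.le)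
    · exact (hS.measurable_weight t v σ).aemeasurable
  have h2 := ENNReal.toReal_mono ENNReal.ofReal_ne_top h1
  rw [ENNReal.toReal_mul, ENNReal.toReal_ofReal (by positivity),
    ENNReal.toReal_ofReal (by positivity)] at h2
  have h3 : x ^ n = Real.exp (n * LambdaCCA (p 0 * p 1 * p 2) t) := by
    rw [hΛ, ← Real.exp_nat_mul]
  have h4 : B / b * Real.exp (n * (LambdaCCA (p 0 * p 1 * p 2) t - t * a)) =
      (x ^ n * B) / (Real.exp (t * (a * n)) * b) := by
    rw [h3, mul_sub, Real.exp_sub]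
    have : (n : ℝ) * (t * a) = t * (a * n) := by ring
    rw [this]
    field_simp
  rw [h4, le_div_iff₀ (by positivity)]
  rw [mul_comm]
  exact h2

lemma IsWalk.ae_upper_aux [Infinite V] (hS : T.IsWalk S) {p : ZMod 3 → ℝ} (hp : ∀ i, 0 < p i)
    (hsum : p 0 + p 1 + p 2 = 1)
    {μ : Measure (V → ZMod 3)} (h : IsProdCol p μ) [IsProbabilityMeasure μ] {t H a : ℝ}
    (ht : 0 < t)
    (hH : ∀ ε > 0, ∀ᶠ n : ℕ in atTop, ((T.level n).card : ℝ) ≤ Real.exp (n * (H + ε)))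
    (ha : LambdaCCA (p 0 * p 1 * p 2) t + H < t * a) :
    ∀ᵐ ω ∂μ, T.speed (S ω) ≤ a := by
  obtain ⟨C, hC, hM⟩ := hS.markov hp hsum h ht
  set Λ := LambdaCCA (p 0 * p 1 * p 2) t
  set ε := (t * a - Λ - H) / 2 with hε
  have hε0 : 0 < ε := by rw [hε]; linarith
  let B : ℕ → Set (V → ZMod 3) := fun n => ⋃ σ ∈ T.level n, {ω | a * T.lev σ < S ω σ}
  have hB : ∀ᶠ n : ℕ in atTop, ‖μ.real (B n)‖ ≤ C * Real.exp (-ε) ^ n := by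
    filter_upwards [hH ε hε0] with n hn
    rw [Real.norm_of_nonneg measureReal_nonneg]
    calc μ.real (B n) ≤ ∑ σ ∈ T.level n, μ.real {ω | a * T.lev σ < S ω σ} :=
          measureReal_biUnion_finset_le _ _
      _ ≤ ∑ σ ∈ T.level n, C * Real.exp (n * (Λ - t * a)) := by
          refine Finset.sum_le_sum fun σ hσ => ?_
          have := hM σ a
          rwa [(T.mem_level _ _).1 hσ] at this ⊢
      _ = (T.level n).card * (C * Real.exp (n * (Λ - t * a))) := by simp
      _ ≤ Real.exp (n * (H + ε)) * (C * Real.exp (n * (Λ - t * a))) := by gcongr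
      _ = C * Real.exp (-ε) ^ n := by
          rw [← Real.exp_nat_mul, mul_left_comm, ← Real.exp_add]
          congr 2
          rw [hε]; ring
  have hsummable : Summable (fun n => μ.real (B n)) := by
    refine Summable.of_norm_bounded_eventually_nat (g := fun n => C * Real.exp (-ε) ^ n) ?_ hB
    refine Summable.mul_left _ (summable_geometric_of_lt_one (Real.exp_pos _).le ?_)
    rw [Real.exp_lt_one_iff]; linarith
  have hne : ∑' n, μ (B n) ≠ ⊤ := by
    have := hsummable.tsum_ofReal_ne_top
    convert this using 3 with n
    rw [Measure.real, ENNReal.ofReal_toReal (measure_ne_top _ _)]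
  filter_upwards [ae_eventually_notMem hne] with ω hω
  refine hS.speed_le ω ?_
  filter_upwards [hω, eventually_gt_atTop 0] with n hn hpos
  rw [div_le_iff₀ (by exact_mod_cast hpos)]
  refine maxS_le fun σ hσ => ?_
  by_contra hcon
  push Not at hcon
  refine hn (Set.mem_biUnion (x := σ) ((T.mem_level _ _).2 hσ) ?_)
  show a * T.lev σ < S ω σ
  rw [hσ]; exact hcon

lemma IsWalk.ae_upper [Infinite V] (hS : T.IsWalk S) {p : ZMod 3 → ℝ} (hp : ∀ i, 0 < p i)
    (hsum : p 0 + p 1 + p 2 = 1)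
    {μ : Measure (V → ZMod 3)} (h : IsProdCol p μ) [IsProbabilityMeasure μ] {t H : ℝ}
    (ht : 0 < t)
    (hH : ∀ ε > 0, ∀ᶠ n : ℕ in atTop, ((T.level n).card : ℝ) ≤ Real.exp (n * (H + ε))) :
    ∀ᵐ ω ∂μ, t * T.speed (S ω) ≤ LambdaCCA (p 0 * p 1 * p 2) t + H := by
  have h1 : ∀ k : ℕ, ∀ᵐ ω ∂μ, T.speed (S ω) ≤
      (LambdaCCA (p 0 * p 1 * p 2) t + H) / t + 1 / ((k : ℝ) + 1) := by
    intro k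
    refine hS.ae_upper_aux hp hsum h ht hH ?_
    rw [mul_add, mul_div_cancel₀ _ ht.ne']
    have : 0 < t * (1 / ((k : ℝ) + 1)) := by positivity
    linarith
  filter_upwards [ae_all_iff.2 h1] with ω hω
  have h2 : T.speed (S ω) ≤ (LambdaCCA (p 0 * p 1 * p 2) t + H) / t := by
    refine le_of_forall_pos_le_add fun ε hε => ?_
    obtain ⟨k, hk⟩ := exists_nat_one_div_lt hε
    exact (hω k).trans (by linarith)
  rw [le_div_iff₀ ht] at h2
  linarith

end RTree

/-! ### Part I: from the graph-theoretic tree to the parent-function tree -/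

section graph
variable {G : SimpleGraph V}

lemma parent_unique (htree : G.IsTree) {r u u' v : V} (hu : G.Adj u v) (hu' : G.Adj u' v)
    (h : G.dist r v = G.dist r u + 1) (h' : G.dist r v = G.dist r u' + 1) : u = u' := by
  obtain ⟨p, hp⟩ := htree.connected.exists_walk_length_eq_dist r u
  obtain ⟨q, hq⟩ := htree.connected.exists_walk_length_eq_dist r u'
  have h1 : (p.concat hu).IsPath := by
    apply SimpleGraph.Walk.isPath_of_length_eq_dist
    rw [SimpleGraph.Walk.length_concat, hp, h]
  have h2 : (q.concat hu').IsPath := by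
    apply SimpleGraph.Walk.isPath_of_length_eq_dist
    rw [SimpleGraph.Walk.length_concat, hq, h']
  have h3 := (htree.existsUnique_path r v).unique h1 h2
  have h4 := congrArg SimpleGraph.Walk.penultimate h3
  simpa using h4

lemma exists_penult (htree : G.IsTree) {a v : V} (hv : v ≠ a) :
    ∃ u, G.Adj u v ∧ G.dist a v = G.dist a u + 1 := by
  obtain ⟨p, hp⟩ := htree.connected.exists_walk_length_eq_dist a v
  have hnil : ¬ p.Nil := fun h => hv h.eq.symm
  have hadj := p.adj_penultimate hnil
  refine ⟨p.penultimate, hadj, ?_⟩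
  have h1 : G.dist a p.penultimate ≤ p.dropLast.length := SimpleGraph.dist_le _
  have h2 : p.dropLast.length + 1 = p.length := by
    have := SimpleGraph.Walk.length_concat p.dropLast hadj
    rw [SimpleGraph.Walk.concat_dropLast] at this
    exact this.symm
  rcases htree.dist_eq_dist_add_one_of_adj a hadj with h3 | h3
  · omega
  · exact h3

/-- the rooted tree attached to a graph-theoretic tree -/
def treeOf (htree : G.IsTree) (hlf : ∀ v : V, (G.neighborSet v).Finite) (r : V) : RTree V where
  r := r
  lev v := G.dist r v
  par v := if h : v ≠ r then (exists_penult htree h).choose else v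
  ch σ := (hlf σ).toFinset.filter (fun c => G.dist r c = G.dist r σ + 1)
  lev_zero v := by
    rw [htree.connected.dist_eq_zero_iff]
    exact eq_comm
  lev_par v hv := by
    rw [dif_pos hv]
    exact (exists_penult htree hv).choose_spec.2
  mem_ch σ c := by
    simp only [Finset.mem_filter, Set.Finite.mem_toFinset, SimpleGraph.mem_neighborSet]
    constructor
    · rintro ⟨h1, h2⟩
      have hc : c ≠ r := by
        rintro rfl
        simp at h2
      refine ⟨hc, ?_⟩
      rw [dif_pos hc]
      have h3 := (exists_penult htree hc).choose_spec
      exact parent_unique htree h3.1 h1 h3.2 h2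
    · rintro ⟨hc, h⟩
      rw [dif_pos hc] at h
      have h3 := (exists_penult htree hc).choose_spec
      rw [h] at h3
      exact h3

variable (htree : G.IsTree) (hlf : ∀ v : V, (G.neighborSet v).Finite) (r : V)

lemma treeOf_ch {σ c : V} :
    c ∈ (treeOf htree hlf r).ch σ ↔ G.Adj σ c ∧ G.dist r c = G.dist r σ + 1 := by
  simp [treeOf]

lemma treeOf_isWalk {S : (V → ZMod 3) → V → ℤ}
    (hS : ∀ (ω : V → ZMod 3) (σ : V) (q : G.Walk r σ), q.IsPath → S ω σ = walkIntCCA ω q) :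
    (treeOf htree hlf r).IsWalk S where
  root ω := by
    have := hS ω r SimpleGraph.Walk.nil SimpleGraph.Walk.IsPath.nil
    have h2 : S ω r = 0 := by simpa [walkIntCCA] using this
    exact h2
  step ω σ c hc := by
    rw [treeOf_ch] at hc
    obtain ⟨p, hp⟩ := htree.connected.exists_walk_length_eq_dist r σ
    have h1 : (p.concat hc.1).IsPath := by
      apply SimpleGraph.Walk.isPath_of_length_eq_dist
      rw [SimpleGraph.Walk.length_concat, hp, hc.2]
    have h2 : p.IsPath := SimpleGraph.Walk.isPath_of_length_eq_dist _ hp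
    rw [hS ω σ p h2, hS ω c _ h1, walkIntCCA, walkIntCCA, SimpleGraph.Walk.darts_concat]
    simp

lemma treeOf_anc_dist {σ τ : V} (h : (treeOf htree hlf r).IsAnc σ τ) :
    G.dist σ τ + G.dist r σ ≤ G.dist r τ := by
  obtain ⟨k, hk⟩ : ∃ k, G.dist r τ = G.dist r σ + k :=
    ⟨G.dist r τ - G.dist r σ, by have : G.dist r σ ≤ G.dist r τ := h.1; omega⟩
  induction k generalizing τ with
  | zero =>
    have h2 := h.2
    have e : (treeOf htree hlf r).lev τ - (treeOf htree hlf r).lev σ = 0 := by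
      show G.dist r τ - G.dist r σ = 0
      omega
    rw [e] at h2
    have : τ = σ := h2
    subst this
    simp
  | succ k ih =>
    have hne : σ ≠ τ := by rintro rfl; omega
    obtain ⟨h1, h2⟩ := (treeOf htree hlf r).isAnc_par h hne
    have h3 : τ ∈ (treeOf htree hlf r).ch ((treeOf htree hlf r).par τ) :=
      ((treeOf htree hlf r).mem_ch _ _).2 ⟨h1, rfl⟩
    rw [treeOf_ch] at h3
    have h4 := ih h2 (by omega)
    have h5 := htree.connected.dist_triangle (u := σ) (v := (treeOf htree hlf r).par τ) (w := τ)
    rw [SimpleGraph.dist_eq_one_iff_adj.2 h3.1] at h5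
    omega

lemma treeOf_anc_of_desc {σ τ : V} (h : IsDesc G r σ τ) : (treeOf htree hlf r).IsAnc σ τ := by
  obtain ⟨k, hk⟩ : ∃ k, G.dist σ τ = k := ⟨_, rfl⟩
  unfold IsDesc at h
  induction k generalizing τ with
  | zero =>
    rw [htree.connected.dist_eq_zero_iff] at hk
    subst hk
    exact (treeOf htree hlf r).isAnc_refl _
  | succ k ih =>
    have hne : τ ≠ σ := by
      rintro rfl
      simp at hk
    obtain ⟨u, hu, hd⟩ := exists_penult htree (a := σ) hne
    have h1 := htree.connected.dist_triangle (u := r) (v := u) (w := τ)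
    have h2 := htree.connected.dist_triangle (u := r) (v := σ) (w := u)
    rw [SimpleGraph.dist_eq_one_iff_adj.2 hu] at h1
    have h3 : (treeOf htree hlf r).IsAnc σ u := ih (by omega) (by omega)
    refine (treeOf htree hlf r).isAnc_trans h3 ((treeOf htree hlf r).isAnc_ch ?_
      ((treeOf htree hlf r).isAnc_refl τ))
    rw [treeOf_ch]
    exact ⟨hu, by omega⟩

lemma treeOf_desc_iff {σ τ : V} : IsDesc G r σ τ ↔ (treeOf htree hlf r).IsAnc σ τ := by
  refine ⟨treeOf_anc_of_desc htree hlf r, fun h => ?_⟩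
  have h1 := treeOf_anc_dist htree hlf r h
  have h2 := htree.connected.dist_triangle (u := r) (v := σ) (w := τ)
  unfold IsDesc
  omega

lemma treeOf_ray {γ : ℕ → V} (h0 : γ 0 = r) (hadj : ∀ n, G.Adj (γ n) (γ (n + 1)))
    (hinj : Function.Injective γ) : (treeOf htree hlf r).IsRay r γ := by
  refine ⟨h0, fun n => ?_⟩
  rw [treeOf_ch]
  refine ⟨hadj n, ?_⟩
  induction n with
  | zero =>
    rcases htree.dist_eq_dist_add_one_of_adj r (hadj 0) with h | h
    · rw [h0] at h; simp at h
    · exact h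
  | succ n ih =>
    rcases htree.dist_eq_dist_add_one_of_adj r (hadj (n + 1)) with h | h
    · have := parent_unique htree (hadj n) (hadj (n + 1)).symm ih h
      have := hinj this
      omega
    · exact h

lemma treeOf_ray' {γ : ℕ → V} (h : (treeOf htree hlf r).IsRay r γ) :
    γ 0 = r ∧ (∀ n, G.Adj (γ n) (γ (n + 1))) ∧ Function.Injective γ := by
  refine ⟨h.1, fun n => ((treeOf_ch htree hlf r).1 (h.2 n)).1, fun a b hab => ?_⟩
  have h1 := (treeOf htree hlf r).ray_lev h a
  have h2 := (treeOf htree hlf r).ray_lev h b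
  rw [hab] at h1
  omega

lemma treeOf_cut {C : Finset V} (h : (treeOf htree hlf r).IsCutBelow r C) (hr : r ∉ C) :
    IsCutset G r C := by
  refine ⟨hr, fun γ h0 h1 h2 => h.2.2 γ (treeOf_ray htree hlf r h0 h1 h2), ?_⟩
  intro σ hσ τ hτ hne hd
  exact hne (h.2.1 σ hσ τ hτ ((treeOf_desc_iff htree hlf r).1 hd))

lemma cutset_nonempty [Infinite V] {C : Finset V} (htree : G.IsTree)
    (hlf : ∀ v : V, (G.neighborSet v).Finite) (h : IsCutset G r C) : C.Nonempty := by
  obtain ⟨γ, hγ⟩ := (treeOf htree hlf r).exists_ray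
  obtain ⟨h0, h1, h2⟩ := treeOf_ray' htree hlf r hγ
  obtain ⟨n, hn⟩ := h.2.1 γ h0 h1 h2
  exact ⟨_, hn⟩

/-- survivors as a finset -/
def survF (n m : ℕ) : Finset V :=
  ((treeOf htree hlf r).level n).filter (fun σ => ∃ τ : V, IsDesc G r σ τ ∧ G.dist r τ = m)

lemma mem_survF {n m : ℕ} {σ : V} : σ ∈ survF htree hlf r n m ↔
    G.dist r σ = n ∧ ∃ τ : V, IsDesc G r σ τ ∧ G.dist r τ = m := by
  rw [survF, Finset.mem_filter, RTree.mem_level]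
  rfl

lemma card_survF (n m : ℕ) : levelSurvivorCount G r n m = (survF htree hlf r n m).card := by
  rw [levelSurvivorCount, ← Set.ncard_coe_finset]
  congr 1
  ext σ
  rw [Finset.mem_coe, mem_survF]
  rfl

lemma card_level (n : ℕ) :
    Set.ncard {σ : V | G.dist r σ = n} = ((treeOf htree hlf r).level n).card := by
  rw [← Set.ncard_coe_finset]
  congr 1
  ext σ
  rw [Finset.mem_coe, RTree.mem_level]
  rfl

lemma survF_cut {n m : ℕ} (hn : 1 ≤ n) (hm : n ≤ m) : IsCutset G r (survF htree hlf r n m) := by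
  refine ⟨?_, ?_, ?_⟩
  · rw [mem_survF]
    rintro ⟨h, _⟩
    simp at h
    omega
  · intro γ h0 h1 h2
    have hγ := treeOf_ray htree hlf r h0 h1 h2
    have hlev : ∀ k, G.dist r (γ k) = k := by
      intro k
      have := (treeOf htree hlf r).ray_lev hγ k
      have hr : (treeOf htree hlf r).lev r = 0 := ((treeOf htree hlf r).lev_zero r).2 rfl
      rw [hr, zero_add] at this
      exact this
    refine ⟨n, ?_⟩
    rw [mem_survF]
    refine ⟨hlev n, γ m, ?_, hlev m⟩
    rw [treeOf_desc_iff htree hlf]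
    have := (treeOf htree hlf r).ray_anc hγ n (m - n)
    rwa [Nat.add_sub_cancel' hm] at this
  · intro σ hσ τ hτ hne hd
    rw [mem_survF] at hσ hτ
    unfold IsDesc at hd
    have : G.dist σ τ = 0 := by omega
    rw [htree.connected.dist_eq_zero_iff] at this
    exact hne this

end graph

/-! ### Part J: entropies, branching number and the conclusion -/

section entropyPart
set_option linter.unusedSectionVars false
variable {G : SimpleGraph V} [Infinite V] (htree : G.IsTree)
  (hlf : ∀ v : V, (G.neighborSet v).Finite) (r : V)

lemma one_le_card_level (n : ℕ) : 1 ≤ ((treeOf htree hlf r).level n).card := by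
  obtain ⟨σ, hσ⟩ := (treeOf htree hlf r).level_nonempty n
  exact Finset.card_pos.2 ⟨σ, ((treeOf htree hlf r).mem_level n σ).2 hσ⟩

lemma card_level_le {H : ℝ} (hbr : ((H : ℝ) : EReal) = volumeEntropy G r) {ε : ℝ} (hε : 0 < ε) :
    ∀ᶠ n : ℕ in atTop, (((treeOf htree hlf r).level n).card : ℝ) ≤ Real.exp (n * (H + ε)) := by
  have h1 : volumeEntropy G r < ((H + ε : ℝ) : EReal) := by
    rw [← hbr]
    exact EReal.coe_lt_coe_iff.2 (by linarith)
  have h2 := eventually_lt_of_limsup_lt h1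
  filter_upwards [h2, eventually_ge_atTop 1] with n hn hn1
  rw [card_level htree hlf r] at hn
  have hn' := EReal.coe_lt_coe_iff.1 hn
  have hnpos : (0 : ℝ) < n := by exact_mod_cast hn1
  rw [div_lt_iff₀ hnpos] at hn'
  have hc : (0 : ℝ) < ((treeOf htree hlf r).level n).card := by
    exact_mod_cast one_le_card_level htree hlf r n
  rw [← Real.log_le_iff_le_exp hc]
  linarith

lemma zpow_dist (l : ℝ) (d : ℕ) : l ^ (-(d : ℤ)) = l⁻¹ ^ d := by
  rw [zpow_neg, zpow_natCast, inv_pow]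

lemma survF_sum (l : ℝ) (n m : ℕ) :
    ∑ σ ∈ survF htree hlf r n m, l ^ (-(G.dist r σ : ℤ))
      = (survF htree hlf r n m).card * l⁻¹ ^ n := by
  rw [Finset.sum_congr rfl (g := fun _ => l⁻¹ ^ n), Finset.sum_const, nsmul_eq_mul]
  intro σ hσ
  rw [mem_survF] at hσ
  rw [zpow_dist, hσ.1]

lemma survF_le (n m : ℕ) :
    (survF htree hlf r n m).card ≤ ((treeOf htree hlf r).level n).card :=
  Finset.card_le_card (Finset.filter_subset _ _)

/-- the set whose infimum is the branching number -/
def brSet (G : SimpleGraph V) (r : V) : Set ℝ :=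
  {l : ℝ | 0 < l ∧ ∀ ε > (0 : ℝ), ∃ C : Finset V, IsCutset G r C ∧
    ∑ σ ∈ C, l ^ (-(G.dist r σ : ℤ)) < ε}

lemma one_le_of_mem_brSet (htree : G.IsTree)
    (hlf : ∀ v : V, (G.neighborSet v).Finite) (r : V) {l : ℝ} (h : l ∈ brSet G r) : 1 ≤ l := by
  by_contra hl
  push Not at hl
  obtain ⟨h0, h⟩ := h
  obtain ⟨C, hC, hs⟩ := h 1 one_pos
  obtain ⟨σ, hσ⟩ := cutset_nonempty r htree hlf hC
  have h1 : l ^ (-(G.dist r σ : ℤ)) ≤ ∑ σ ∈ C, l ^ (-(G.dist r σ : ℤ)) :=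
    Finset.single_le_sum (f := fun σ => l ^ (-(G.dist r σ : ℤ)))
      (fun i _ => (zpow_pos h0 _).le) hσ
  rw [zpow_dist] at h1
  have h2 : (1 : ℝ) ≤ l⁻¹ ^ G.dist r σ := one_le_pow₀ (one_le_inv_iff₀.2 ⟨h0, hl.le⟩)
  linarith

lemma brSet_nonempty (htree : G.IsTree)
    (hlf : ∀ v : V, (G.neighborSet v).Finite) (r : V) {H : ℝ} (hbr : ((H : ℝ) : EReal) = volumeEntropy G r) :
    (brSet G r).Nonempty := by
  refine ⟨Real.exp (H + 2), Real.exp_pos _, ?_⟩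
  intro ε hε
  have h1 := card_level_le htree hlf r hbr one_pos
  have h2 : Tendsto (fun n : ℕ => Real.exp (-(n : ℝ))) atTop (nhds 0) :=
    Real.tendsto_exp_neg_atTop_nhds_zero.comp tendsto_natCast_atTop_atTop
  obtain ⟨n, hn1, hn2, hn3⟩ :=
    (h1.and ((h2.eventually_lt_const hε).and (eventually_ge_atTop 1))).exists
  refine ⟨survF htree hlf r n n, survF_cut htree hlf r hn3 le_rfl, ?_⟩
  rw [survF_sum]
  have h3 : ((survF htree hlf r n n).card : ℝ) ≤ Real.exp (n * (H + 1)) :=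
    le_trans (by exact_mod_cast survF_le htree hlf r n n) hn1
  calc ((survF htree hlf r n n).card : ℝ) * (Real.exp (H + 2))⁻¹ ^ n
      ≤ Real.exp (n * (H + 1)) * (Real.exp (H + 2))⁻¹ ^ n := by gcongr
    _ = Real.exp (-(n : ℝ)) := by
        rw [← Real.exp_neg, ← Real.exp_nat_mul, ← Real.exp_add]
        congr 1
        ring
    _ < ε := hn2

lemma one_le_br (htree : G.IsTree)
    (hlf : ∀ v : V, (G.neighborSet v).Finite) (r : V) {H : ℝ} (hbr : ((H : ℝ) : EReal) = volumeEntropy G r) :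
    1 ≤ branchingNumber G r :=
  le_csInf (brSet_nonempty htree hlf r hbr) (fun _ h => one_le_of_mem_brSet htree hlf r h)

lemma cut_bound {l : ℝ} (hl : 0 < l) (hlt : l < branchingNumber G r) :
    ∃ ε > (0 : ℝ), ∀ C : Finset V, IsCutset G r C →
      ε ≤ ∑ σ ∈ C, l ^ (-(G.dist r σ : ℤ)) := by
  have h : l ∉ brSet G r := notMem_of_lt_csInf hlt ⟨0, fun x hx => hx.1.le⟩
  by_contra hc
  push Not at hc
  exact h ⟨hl, hc⟩

lemma rVol_eq (htree : G.IsTree)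
    (hlf : ∀ v : V, (G.neighborSet v).Finite) (r : V) (hbr : ((Real.log (branchingNumber G r) : ℝ) : EReal) = volumeEntropy G r)
    {ρ : ℝ} (hρ : 1 < ρ) :
    rVolumeEntropy G r ρ = ((Real.log (branchingNumber G r) : ℝ) : EReal) := by
  have hb1 := one_le_br htree hlf r hbr
  have hfl : ∀ n : ℕ, n ≤ ⌊ρ * n⌋₊ := fun n => Nat.le_floor (by
    have : (0 : ℝ) ≤ n := n.cast_nonneg
    nlinarith)
  apply le_antisymm
  · rw [hbr]
    refine limsup_le_limsup ?_
    filter_upwards [eventually_ge_atTop 1] with n hn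
    rw [card_survF htree hlf r, card_level htree hlf r]
    apply EReal.coe_le_coe_iff.2
    have hpos : 0 < (survF htree hlf r n ⌊ρ * n⌋₊).card :=
      Finset.card_pos.2 (cutset_nonempty r htree hlf (survF_cut htree hlf r hn (hfl n)))
    have h1 : (0 : ℝ) < (survF htree hlf r n ⌊ρ * n⌋₊).card := by exact_mod_cast hpos
    have h2 : ((survF htree hlf r n ⌊ρ * n⌋₊).card : ℝ) ≤ ((treeOf htree hlf r).level n).card := by
      exact_mod_cast survF_le htree hlf r n _
    exact div_le_div_of_nonneg_right (Real.log_le_log h1 h2) n.cast_nonneg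
  · refine le_of_forall_lt_imp_le_of_dense ?_
    intro a ha
    obtain ⟨c, hac, hcH⟩ := EReal.lt_iff_exists_real_btwn.1 ha
    have hcH := EReal.coe_lt_coe_iff.1 hcH
    refine hac.le.trans ?_
    obtain ⟨d, hcd, hdH⟩ := exists_between hcH
    obtain ⟨ε, hε, hcut⟩ := cut_bound (G := G) r (Real.exp_pos d)
      ((Real.lt_log_iff_exp_lt (by linarith)).1 hdH)
    have hlim : Tendsto (fun n : ℕ => d + Real.log ε / n) atTop (nhds (d + 0)) :=
      tendsto_const_nhds.add (tendsto_const_div_atTop_nhds_zero_nat _)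
    rw [add_zero] at hlim
    refine le_limsup_of_frequently_le (Eventually.frequently ?_) (by isBoundedDefault)
    filter_upwards [hlim.eventually_const_lt hcd, eventually_ge_atTop 1] with n hn hn1
    rw [card_survF htree hlf r]
    apply EReal.coe_le_coe_iff.2
    have hcn := hcut _ (survF_cut htree hlf r hn1 (hfl n))
    rw [survF_sum, ← Real.exp_neg, ← Real.exp_nat_mul] at hcn
    have hnpos : (0 : ℝ) < n := by exact_mod_cast hn1
    have hpos : 0 < (survF htree hlf r n ⌊ρ * n⌋₊).card :=
      Finset.card_pos.2 (cutset_nonempty r htree hlf (survF_cut htree hlf r hn1 (hfl n)))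
    have h1 : (0 : ℝ) < (survF htree hlf r n ⌊ρ * n⌋₊).card := by exact_mod_cast hpos
    have h3 := Real.log_le_log hε hcn
    rw [Real.log_mul h1.ne' (Real.exp_pos _).ne', Real.log_exp] at h3
    refine hn.le.trans ?_
    rw [le_div_iff₀ hnpos, add_mul, div_mul_cancel₀ _ hnpos.ne']
    linarith

lemma reduced_eq (htree : G.IsTree)
    (hlf : ∀ v : V, (G.neighborSet v).Finite) (r : V) (hbr : ((Real.log (branchingNumber G r) : ℝ) : EReal) = volumeEntropy G r) :
    reducedVolumeEntropy G r = ((Real.log (branchingNumber G r) : ℝ) : EReal) := by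
  have h : ∀ᶠ ρ in nhdsWithin (1 : ℝ) (Set.Ioi (1 : ℝ)),
      rVolumeEntropy G r ρ = ((Real.log (branchingNumber G r) : ℝ) : EReal) := by
    filter_upwards [self_mem_nhdsWithin] with ρ hρ
    exact rVol_eq htree hlf r hbr hρ
  rw [reducedVolumeEntropy, limsup_congr h, limsup_const]

lemma prod_le_27 {a b c : ℝ} (ha : 0 < a) (hb : 0 < b) (hc : 0 < c) (h : a + b + c = 1) :
    a * b * c ≤ 1 / 27 := by
  have hc' : c = 1 - a - b := by linarith
  nlinarith [mul_nonneg ha.le (sq_nonneg (b - c)), mul_nonneg hb.le (sq_nonneg (a - c)),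
    mul_nonneg hc.le (sq_nonneg (a - b)),
    mul_nonneg ha.le (sq_nonneg (a - b)), mul_nonneg ha.le (sq_nonneg (a - c)),
    mul_nonneg hb.le (sq_nonneg (b - c)), mul_nonneg hb.le (sq_nonneg (a - b)),
    mul_nonneg hc.le (sq_nonneg (a - c)), mul_nonneg hc.le (sq_nonneg (b - c)),
    show (a + b + c) ^ 3 = 1 by rw [h]; norm_num]

lemma ae_lower_all (hbr : ((Real.log (branchingNumber G r) : ℝ) : EReal) = volumeEntropy G r)
    {p : ZMod 3 → ℝ} (hp : ∀ i, 0 < p i) (hsum : p 0 + p 1 + p 2 = 1)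
    {μ : Measure (V → ZMod 3)} [IsProbabilityMeasure μ] (hμ : IsProdCol p μ)
    {S : (V → ZMod 3) → V → ℤ} (hS : (treeOf htree hlf r).IsWalk S) {t : ℝ} (ht : 0 < t)
    (hJ : cubJ (p 0 * p 1 * p 2) t < Real.log (branchingNumber G r)) :
    ∀ᵐ ω ∂μ, cubD (p 0 * p 1 * p 2) t ≤ (treeOf htree hlf r).speed (S ω) := by
  have hb1 := one_le_br htree hlf r hbr
  obtain ⟨d, hJd, hdH⟩ := exists_between hJ
  obtain ⟨ε, hε, hcut⟩ := cut_bound (G := G) r (Real.exp_pos d)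
    ((Real.lt_log_iff_exp_lt (by linarith)).1 hdH)
  have key : ∀ k : ℕ, ∀ᵐ ω ∂μ, cubD (p 0 * p 1 * p 2) t - 1 / ((k : ℝ) + 1) ≤
      (treeOf htree hlf r).speed (S ω) := by
    intro k
    set J := cubJ (p 0 * p 1 * p 2) t with hJdef
    have hk : (0 : ℝ) < 1 / ((k : ℝ) + 1) := by positivity
    have hg : 0 < (d - J) / (2 * t) := div_pos (by linarith) (by linarith)
    have hδ : 0 < min (1 / ((k : ℝ) + 1)) ((d - J) / (2 * t)) := lt_min hk hg
    have h1 : t * min (1 / ((k : ℝ) + 1)) ((d - J) / (2 * t)) ≤ (d - J) / 2 := by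
      calc _ ≤ t * ((d - J) / (2 * t)) := by gcongr; exact min_le_right _ _
        _ = (d - J) / 2 := by field_simp
    have := hS.ae_lower (μ := μ) hp hsum hμ (l := Real.exp d) (ε := ε) (t := t)
      (δ := min (1 / ((k : ℝ) + 1)) ((d - J) / (2 * t))) (Real.exp_pos d) hε ?_ ht hδ ?_
    · filter_upwards [this] with ω hω
      have := min_le_left (1 / ((k : ℝ) + 1)) ((d - J) / (2 * t))
      linarith
    · intro C hC hrC
      have h := hcut C (treeOf_cut htree hlf r hC hrC)
      rw [Finset.sum_congr rfl (fun σ _ => zpow_dist (Real.exp d) (G.dist r σ))] at h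
      exact h
    · rw [Real.log_exp]
      linarith
  filter_upwards [ae_all_iff.2 key] with ω hω
  have hlim : Tendsto (fun k : ℕ => cubD (p 0 * p 1 * p 2) t - 1 / ((k : ℝ) + 1)) atTop
      (nhds (cubD (p 0 * p 1 * p 2) t - 0)) :=
    tendsto_const_nhds.sub tendsto_one_div_add_atTop_nhds_zero_nat
  rw [sub_zero] at hlim
  exact le_of_tendsto' hlim hω

end entropyPart

/-- On an infinite tree with `log br(Γ) = h(Γ)`: almost surely, if
`br(Γ) ≥ (p₀p₁p₂)^{-1/3}` then the cloud speed of the CCA tree-indexed walk is 1;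
otherwise it is < 1 and `Λ*_CCA(v_c) = h̄(Γ)`. -/
theorem cca_cloud_speed_dichotomy [Infinite V] (G : SimpleGraph V) (htree : G.IsTree)
    (hlf : ∀ v : V, (G.neighborSet v).Finite) (r : V)
    (hbr : ((Real.log (branchingNumber G r) : ℝ) : EReal) = volumeEntropy G r)
    (p : ZMod 3 → ℝ) (hp : ∀ i, 0 < p i) (hsum : p 0 + p 1 + p 2 = 1)
    (μ : Measure (V → ZMod 3)) [IsProbabilityMeasure μ]
    (hμ : ∀ (s : Finset V) (κ : V → ZMod 3),
      μ {ω : V → ZMod 3 | ∀ u ∈ s, ω u = κ u} = ∏ u ∈ s, ENNReal.ofReal (p (κ u)))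
    (S : (V → ZMod 3) → V → ℤ)
    (hS : ∀ (ω : V → ZMod 3) (σ : V) (q : G.Walk r σ), q.IsPath →
      S ω σ = walkIntCCA ω q) :
    ∀ᵐ ω ∂μ,
      ((p 0 * p 1 * p 2) ^ (-(1 / 3) : ℝ) ≤ branchingNumber G r →
        cloudSpeed G r (S ω) = 1) ∧
      (branchingNumber G r < (p 0 * p 1 * p 2) ^ (-(1 / 3) : ℝ) →
        cloudSpeed G r (S ω) < 1 ∧
        LstarCCA (p 0 * p 1 * p 2) (cloudSpeed G r (S ω)) = reducedVolumeEntropy G r) := by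
  have hwalk := treeOf_isWalk htree hlf r hS
  have hb1 := one_le_br htree hlf r hbr
  have hb0 : 0 < branchingNumber G r := by linarith
  have hq : 0 < p 0 * p 1 * p 2 := mul_pos (mul_pos (hp 0) (hp 1)) (hp 2)
  have hq' := prod_le_27 (hp 0) (hp 1) (hp 2) hsum
  have hup : ∀ t : ℚ, ∀ᵐ ω ∂μ, 0 < (t : ℝ) → (t : ℝ) * (treeOf htree hlf r).speed (S ω) ≤
      LambdaCCA (p 0 * p 1 * p 2) t + Real.log (branchingNumber G r) := by
    intro t
    by_cases ht : 0 < (t : ℝ)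
    · filter_upwards [hwalk.ae_upper (μ := μ) hp hsum hμ ht
        (fun ε hε => card_level_le htree hlf r hbr hε)] with ω hω _
      exact hω
    · exact Eventually.of_forall (fun ω h => absurd h ht)
  have hlow : ∀ t : ℚ, ∀ᵐ ω ∂μ, 0 < (t : ℝ) →
      cubJ (p 0 * p 1 * p 2) t < Real.log (branchingNumber G r) →
      cubD (p 0 * p 1 * p 2) t ≤ (treeOf htree hlf r).speed (S ω) := by
    intro t
    by_cases ht : 0 < (t : ℝ) ∧ cubJ (p 0 * p 1 * p 2) t < Real.log (branchingNumber G r)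
    · filter_upwards [ae_lower_all htree hlf r hbr hp hsum hμ hwalk ht.1 ht.2] with ω hω _ _
      exact hω
    · exact Eventually.of_forall (fun ω h h' => absurd ⟨h, h'⟩ ht)
  have hrp : (p 0 * p 1 * p 2) ^ (-(1 / 3) : ℝ)
      = Real.exp (-(1 / 3) * Real.log (p 0 * p 1 * p 2)) := by
    rw [Real.rpow_def_of_pos hq, mul_comm]
  filter_upwards [ae_all_iff.2 hup, ae_all_iff.2 hlow] with ω hω1 hω2
  have hfin := deterministic_conclusion hq hq' (Real.log_nonneg hb1) (hwalk.speed_le_one ω)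
    hω1 hω2
  have hsp : cloudSpeed G r (S ω) = (treeOf htree hlf r).speed (S ω) := rfl
  rw [hsp, hrp, reduced_eq htree hlf r hbr]
  refine ⟨fun h => hfin.1 ?_, fun h => hfin.2 ?_⟩
  · exact (Real.le_log_iff_exp_le hb0).2 h
  · exact (Real.log_lt_iff_lt_exp hb0).2 h
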